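/- arXiv:1906.06087 — 3 statements merged into one kernel-verified Lean document; each statement's English description precedes it below -/
import Mathlib

section
/- Let h be a uniformly almost periodic function on \mathbb{R} with spectrum contained in [0, \infty), such that h is invertible in the algebra of almost periodic functions with 1/h also having spectrum in [0, \infty). Then the mean value \hat{h}(0) = m(h) is nonzero, the Poisson extension H of h to the closed upper half-plane has no zeros, and |H| is bounded below by a positive constant on the upper half-plane. -/
open Complex Filter

/-- A trigonometric polynomial on `ℝ`. -/
def IsTrigPoly (p : ℝ → ℂ) : Prop :=
  ∃ (s : Finset ℝ) (c : ℝ → ℂ), ∀ x : ℝ,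
    p x = ∑ ω ∈ s, c ω * Complex.exp (Complex.I * ω * x)

/-- Bohr's uniformly almost periodic functions. -/
def IsUAP (f : ℝ → ℂ) : Prop :=
  Continuous f ∧ ∀ ε : ℝ, 0 < ε → ∃ p : ℝ → ℂ, IsTrigPoly p ∧ ∀ x : ℝ, ‖f x - p x‖ < ε

/-- The Bohr–Fourier coefficient of `f` at frequency `ω` vanishes. -/
def BohrCoeffZero (f : ℝ → ℂ) (ω : ℝ) : Prop :=
  Tendsto (fun L : ℝ =>
      (2 * L)⁻¹ • ∫ t in (-L)..L, f t * Complex.exp (-(Complex.I * ω * t)))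
    atTop (nhds 0)

/-- `h ∈ HU(ℝ)`: uniformly almost periodic with spectrum in `[0,∞)`. -/
def IsHU (h : ℝ → ℂ) : Prop :=
  IsUAP h ∧ ∀ ω : ℝ, ω < 0 → BohrCoeffZero h ω

/-- The Poisson extension of `h` to the closed upper half-plane:
`H(x+iy) = ∫ P_y(s) h(x-s) ds` for `y > 0`, and `H = h` on `ℝ`. -/
noncomputable def poissonExt (h : ℝ → ℂ) (z : ℂ) : ℂ :=
  if z.im = 0 then h z.re
  else ∫ s : ℝ, (z.im / (Real.pi * (s ^ 2 + z.im ^ 2))) • h (z.re - s)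

section
open scoped BoundedContinuousFunction
open MeasureTheory

namespace IHU

/-- the exponential with frequency `ω` -/
noncomputable def e (ω : ℝ) : ℝ →ᵇ ℂ :=
  BoundedContinuousFunction.ofNormedAddCommGroup
    (fun x : ℝ => Complex.exp (Complex.I * ω * x)) (by fun_prop) 1 (fun x => by
      rw [Complex.norm_exp]; simp)

lemma e_apply (ω x : ℝ) : e ω x = Complex.exp (Complex.I * ω * x) := rfl

lemma e_mul (a b : ℝ) : e a * e b = e (a + b) := by
  ext x
  simp only [BoundedContinuousFunction.coe_mul, Pi.mul_apply, e_apply]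
  rw [← Complex.exp_add]; congr 1; push_cast; ring

lemma e_zero : e 0 = 1 := by
  ext x; simp [e_apply]

lemma norm_e_le (ω : ℝ) : ‖e ω‖ ≤ 1 :=
  BoundedContinuousFunction.norm_ofNormedAddCommGroup_le _ zero_le_one _

/-- symmetric averages -/
noncomputable def avg (f : ℝ →ᵇ ℂ) (L : ℝ) : ℂ := (2 * L)⁻¹ • ∫ t in (-L)..L, f t

lemma avg_add (f g : ℝ →ᵇ ℂ) (L : ℝ) : avg (f + g) L = avg f L + avg g L := by
  unfold avg
  simp only [BoundedContinuousFunction.coe_add, Pi.add_apply]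
  rw [intervalIntegral.integral_add (f.continuous.intervalIntegrable _ _)
    (g.continuous.intervalIntegrable _ _), smul_add]

lemma avg_smul (c : ℂ) (f : ℝ →ᵇ ℂ) (L : ℝ) : avg (c • f) L = c • avg f L := by
  unfold avg
  simp only [BoundedContinuousFunction.coe_smul]
  rw [intervalIntegral.integral_smul, smul_comm]

lemma norm_avg_le {F K : ℝ →ᵇ ℂ} {C : ℝ} (hFK : ∀ t, ‖F t‖ ≤ C * (K t).re) {L : ℝ} (hL : 0 < L) :
    ‖avg F L‖ ≤ C * (avg K L).re := by
  unfold avg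
  have h1 : ‖∫ t in (-L)..L, F t‖ ≤ ∫ t in (-L)..L, C * (K t).re := by
    apply intervalIntegral.norm_integral_le_of_norm_le (by linarith)
    · exact Filter.Eventually.of_forall fun t _ => hFK t
    · apply Continuous.intervalIntegrable
      have := K.continuous
      fun_prop
  have h2 : ∫ t in (-L)..L, C * (K t).re = C * (∫ t in (-L)..L, K t).re := by
    rw [intervalIntegral.integral_const_mul]
    congr 1
    exact (Complex.reCLM.intervalIntegral_comp_comm (K.continuous.intervalIntegrable _ _))
  rw [norm_smul, Complex.smul_re, Real.norm_of_nonneg (by positivity), smul_eq_mul]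
  rw [h2] at h1
  calc _ ≤ (2 * L)⁻¹ * (C * (∫ t in (-L)..L, K t).re) := by gcongr
    _ = _ := by ring

lemma avg_one {L : ℝ} (hL : 0 < L) : avg 1 L = 1 := by
  unfold avg
  have hL' : (L : ℂ) ≠ 0 := by exact_mod_cast hL.ne'
  simp
  field_simp
  norm_num

lemma norm_avg_le_norm (f : ℝ →ᵇ ℂ) {L : ℝ} (hL : 0 < L) : ‖avg f L‖ ≤ ‖f‖ := by
  have := norm_avg_le (F := f) (K := 1) (C := ‖f‖) (fun t => by simpa using f.norm_coe_le_norm t) hL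
  simpa [avg_one hL] using this

lemma tendsto_avg_e {ω : ℝ} (hω : ω ≠ 0) : Tendsto (avg (e ω)) atTop (nhds 0) := by
  have hb : ∀ L : ℝ, 0 < L → ‖avg (e ω) L‖ ≤ |ω|⁻¹ * L⁻¹ := by
    intro L hL
    unfold avg
    simp only [e_apply]
    have hc : Complex.I * ω ≠ 0 := by simp [hω]
    rw [integral_exp_mul_complex hc, norm_smul, norm_div, Real.norm_of_nonneg (by positivity)]
    have h1 : ‖Complex.exp (Complex.I * ω * (L : ℝ)) - Complex.exp (Complex.I * ω * ((-L : ℝ) : ℂ))‖ ≤ 2 := by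
      refine (norm_sub_le _ _).trans ?_
      rw [Complex.norm_exp, Complex.norm_exp]; simp; norm_num
    have h2 : ‖Complex.I * (ω : ℂ)‖ = |ω| := by simp
    rw [h2]
    calc _ ≤ (2 * L)⁻¹ * (2 / |ω|) := by gcongr
      _ = _ := by field_simp
  refine squeeze_zero_norm' ((eventually_gt_atTop 0).mono hb) ?_
  simpa using tendsto_inv_atTop_zero.const_mul (|ω|⁻¹)

/-- an ultrafilter converging to infinity -/
noncomputable def U : Ultrafilter ℝ := Ultrafilter.of atTop

lemma U_le : (U : Filter ℝ) ≤ atTop := Ultrafilter.of_le _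

lemma tendsto_avg (f : ℝ →ᵇ ℂ) : Tendsto (avg f) U (nhds (limUnder (U : Filter ℝ) (avg f))) := by
  apply tendsto_nhds_limUnder
  have hc : IsCompact (Metric.closedBall (0 : ℂ) ‖f‖) := isCompact_closedBall _ _
  obtain ⟨x, -, hx⟩ := hc.ultrafilter_le_nhds (U.map (avg f)) (by
    rw [Filter.le_principal_iff]
    apply U_le
    filter_upwards [eventually_gt_atTop 0] with L hL
    simpa using norm_avg_le_norm f hL)
  exact ⟨x, hx⟩

/-- the mean -/
noncomputable def M : (ℝ →ᵇ ℂ) →L[ℂ] ℂ :=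
  LinearMap.mkContinuous
    { toFun := fun f => limUnder (U : Filter ℝ) (avg f)
      map_add' := fun f g => by
        refine Tendsto.limUnder_eq ?_
        refine ((tendsto_avg f).add (tendsto_avg g)).congr fun L => (avg_add f g L).symm
      map_smul' := fun c f => by
        refine Tendsto.limUnder_eq ?_
        refine ((tendsto_avg f).const_smul c).congr fun L => (avg_smul c f L).symm } 1 (fun f => by
    rw [one_mul]
    refine le_of_tendsto (tendsto_avg f).norm ?_
    apply U_le
    filter_upwards [eventually_gt_atTop 0] with L hL
    exact norm_avg_le_norm f hL)

lemma tendsto_M (f : ℝ →ᵇ ℂ) : Tendsto (avg f) U (nhds (M f)) := tendsto_avg f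

lemma M_eq {f : ℝ →ᵇ ℂ} {m : ℂ} (h : Tendsto (avg f) atTop (nhds m)) : M f = m :=
  tendsto_nhds_unique (tendsto_M f) (h.mono_left U_le)

lemma norm_M_le {F K : ℝ →ᵇ ℂ} {C : ℝ} (hFK : ∀ t, ‖F t‖ ≤ C * (K t).re) :
    ‖M F‖ ≤ C * (M K).re := by
  refine le_of_tendsto_of_tendsto (tendsto_M F).norm
    (((Complex.continuous_re.tendsto _).comp (tendsto_M K)).const_mul C) ?_
  apply U_le
  filter_upwards [eventually_gt_atTop 0] with L hL
  exact norm_avg_le hFK hL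

lemma M_e (ω : ℝ) : M (e ω) = if ω = 0 then 1 else 0 := by
  split_ifs with h
  · subst h
    rw [e_zero]
    apply M_eq
    refine tendsto_const_nhds.congr' ?_
    filter_upwards [eventually_gt_atTop 0] with L hL
    exact (avg_one hL).symm
  · exact M_eq (tendsto_avg_e h)

lemma norm_M_le_norm (f : ℝ →ᵇ ℂ) : ‖M f‖ ≤ ‖f‖ := by
  have := norm_M_le (F := f) (K := e 0) (C := ‖f‖) (fun t => by
    simpa [e_zero] using f.norm_coe_le_norm t)
  simpa [M_e] using this

/-- The span of the exponentials with nonnegative frequencies. -/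
noncomputable def Sp : Submodule ℂ (ℝ →ᵇ ℂ) := Submodule.span ℂ (e '' Set.Ici 0)

lemma mult_of_mem_closure (Λ : (ℝ →ᵇ ℂ) →L[ℂ] ℂ)
    (hΛ : ∀ a b : ℝ, 0 ≤ a → 0 ≤ b → Λ (e (a + b)) = Λ (e a) * Λ (e b))
    {f g : ℝ →ᵇ ℂ} (hf : f ∈ closure (Sp : Set (ℝ →ᵇ ℂ))) (hg : g ∈ closure (Sp : Set (ℝ →ᵇ ℂ))) :
    Λ (f * g) = Λ f * Λ g := by
  have key : ∀ f ∈ Sp, ∀ g ∈ Sp, Λ (f * g) - Λ f * Λ g = 0 := by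
    intro f hf g hg
    rw [sub_eq_zero]
    refine Submodule.span_induction₂ (p := fun f g _ _ => Λ (f * g) = Λ f * Λ g)
      ?_ ?_ ?_ ?_ ?_ ?_ ?_ hf hg
    · rintro _ _ ⟨a, ha, rfl⟩ ⟨b, hb, rfl⟩
      rw [e_mul, hΛ a b ha hb]
    · intro y _; simp
    · intro x _; simp
    · intro x y z _ _ _ h1 h2; simp [add_mul, h1, h2]
    · intro x y z _ _ _ h1 h2; simp [mul_add, h1, h2]
    · intro r x y _ _ h1; simp [h1, mul_assoc]
    · intro r x y _ _ h1; simp [h1]; ring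
  have hcont : Continuous (Function.uncurry fun f g : ℝ →ᵇ ℂ => Λ (f * g) - Λ f * Λ g) := by
    unfold Function.uncurry; fun_prop
  have := map_mem_closure₂ (u := {(0 : ℂ)}) hcont hf hg (fun a ha b hb => key a ha b hb)
  rw [closure_singleton] at this
  exact sub_eq_zero.1 this

/-- Følner sets -/
lemma folner (s : Finset ℝ) {δ : ℝ} (hδ : 0 < δ) : ∃ A : Finset ℝ, A.Nonempty ∧ ∀ ω ∈ s,
    (1 - δ) * A.card ≤ ((A ×ˢ A).filter fun q => q.1 - q.2 = ω).card := by
  classical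
  let A : ℕ → Finset ℝ := fun n => (Finset.univ : Finset (s → Fin (n + 1))).image
    fun k => ∑ w : s, ((k w : ℕ) : ℝ) * (w : ℝ)
  have hne : ∀ n, (A n).Nonempty := fun n => Finset.univ_nonempty.image _
  have hcard : ∀ n, (A n).card ≤ (n + 1) ^ s.card := by
    intro n
    refine Finset.card_image_le.trans ?_
    simp
  have hmono : ∀ n, A n ⊆ A (n + 1) := by
    intro n x hx
    simp only [A, Finset.mem_image, Finset.mem_univ, true_and] at hx ⊢
    obtain ⟨k, rfl⟩ := hx
    exact ⟨fun w => (k w).castSucc, by simp⟩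
  have hshift : ∀ n, ∀ ω ∈ s, ∀ x ∈ A n, x + ω ∈ A (n + 1) := by
    intro n ω hω x hx
    simp only [A, Finset.mem_image, Finset.mem_univ, true_and] at hx ⊢
    obtain ⟨k, rfl⟩ := hx
    refine ⟨fun w => if w = ⟨ω, hω⟩ then (k w).succ else (k w).castSucc, ?_⟩
    have : ∀ w : s, (((if w = ⟨ω, hω⟩ then (k w).succ else (k w).castSucc : Fin (n + 1 + 1)) : ℕ) : ℝ) * (w : ℝ)
        = ((k w : ℕ) : ℝ) * (w : ℝ) + (if w = ⟨ω, hω⟩ then (w : ℝ) else 0) := by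
      intro w
      split_ifs <;> simp; ring
    simp only [this, Finset.sum_add_distrib]
    simp
  have hlow : ∀ n, ∀ ω ∈ s,
      (A n).card ≤ (((A (n+1)) ×ˢ (A (n+1))).filter fun q => q.1 - q.2 = ω).card := by
    intro n ω hω
    refine Finset.card_le_card_of_injOn (fun x => (x + ω, x)) ?_ ?_
    · intro x hx
      simp only [Finset.coe_filter, Finset.mem_product, Set.mem_ofPred_eq]
      exact ⟨⟨hshift n ω hω x hx, hmono n hx⟩, by simp⟩
    · intro x _ y _ hxy
      exact (Prod.ext_iff.1 hxy).2
  by_contra hcon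
  push Not at hcon
  have hstep : ∀ n, ((A n).card : ℝ) ≤ (1 - δ) * (A (n + 1)).card := by
    intro n
    obtain ⟨ω, hω, h1⟩ := hcon (A (n+1)) (hne _)
    exact (Nat.cast_le.2 (hlow n ω hω)).trans h1.le
  have hδ1 : 0 < 1 - δ := by
    have h0 := hstep 0
    have h1 : (0 : ℝ) < (A 0).card := by exact_mod_cast (hne 0).card_pos
    have h2 : (0 : ℝ) ≤ (A 1).card := by positivity
    by_contra h3
    push Not at h3
    have : (1 - δ) * (A (0+1)).card ≤ 0 := mul_nonpos_of_nonpos_of_nonneg h3 h2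
    linarith
  set r : ℝ := (1 - δ)⁻¹
  have hr : 1 < r := (one_lt_inv₀ hδ1).2 (by linarith)
  have hgrow : ∀ n, r ^ n ≤ (A n).card := by
    intro n
    induction n with
    | zero => simpa using (hne 0).card_pos
    | succ n ih =>
      have := hstep n
      rw [pow_succ]
      have h3 : r ^ n ≤ (1 - δ) * (A (n + 1)).card := ih.trans this
      calc r ^ n * r ≤ ((1 - δ) * (A (n + 1)).card) * r := by gcongr
        _ = _ := by simp only [r]; field_simp
  have hlim := tendsto_pow_const_div_const_pow_of_one_lt s.card hr
  have hlim2 := (tendsto_add_atTop_iff_nat 1).2 hlim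
  have hev := hlim2.eventually (gt_mem_nhds (show (0 : ℝ) < r⁻¹ by positivity))
  obtain ⟨n, hn⟩ := hev.exists
  have hrn : 0 < r ^ (n + 1) := by positivity
  rw [div_lt_iff₀ hrn] at hn
  have h5 : r⁻¹ * r ^ (n + 1) = r ^ n := by
    rw [pow_succ]; field_simp
  rw [h5] at hn
  have h6 : ((A n).card : ℝ) ≤ ((n + 1 : ℕ) : ℝ) ^ s.card := by exact_mod_cast hcard n
  exact absurd (hgrow n) (not_le.2 (lt_of_le_of_lt h6 hn))

/-- Bochner–Fejér type operator -/
noncomputable def R (A : Finset ℝ) : (ℝ →ᵇ ℂ) →ₗ[ℂ] (ℝ →ᵇ ℂ) where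
  toFun f := (A.card : ℂ)⁻¹ • ∑ q ∈ A ×ˢ A, M (f * e (q.2 - q.1)) • e (q.1 - q.2)
  map_add' f g := by
    simp only [add_mul, map_add, add_smul, Finset.sum_add_distrib, smul_add]
  map_smul' c f := by
    simp only [smul_mul_assoc, map_smul, smul_assoc, ← Finset.smul_sum, RingHom.id_apply]
    rw [smul_comm]

lemma R_apply (A : Finset ℝ) (f : ℝ →ᵇ ℂ) : R A f =
    (A.card : ℂ)⁻¹ • ∑ q ∈ A ×ˢ A, M (f * e (q.2 - q.1)) • e (q.1 - q.2) := rfl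

lemma R_e (A : Finset ℝ) (ω : ℝ) : R A (e ω) =
    ((A.card : ℂ)⁻¹ * ((A ×ˢ A).filter fun q => q.1 - q.2 = ω).card) • e ω := by
  rw [R_apply, mul_smul]
  congr 1
  have : ∀ q ∈ A ×ˢ A, M (e ω * e (q.2 - q.1)) • e (q.1 - q.2)
      = if q.1 - q.2 = ω then e ω else 0 := by
    intro q _
    rw [e_mul, M_e]
    by_cases h : q.1 - q.2 = ω
    · rw [if_pos h, if_pos (by linarith), one_smul, h]
    · rw [if_neg h, if_neg (by contrapose h; linarith), zero_smul]
  rw [Finset.sum_congr rfl this, ← Finset.sum_filter, Finset.sum_const, Nat.cast_smul_eq_nsmul]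

lemma norm_R_le {A : Finset ℝ} (hA : A.Nonempty) (f : ℝ →ᵇ ℂ) : ‖R A f‖ ≤ ‖f‖ := by
  have hc : (A.card : ℂ) ≠ 0 := by exact_mod_cast hA.card_pos.ne'
  rw [BoundedContinuousFunction.norm_le (norm_nonneg _)]
  intro x
  let K : ℝ →ᵇ ℂ := (A.card : ℂ)⁻¹ • ∑ q ∈ A ×ˢ A, e (q.1 - q.2) x • e (q.2 - q.1)
  have h1 : R A f x = M (f * K) := by
    simp only [R_apply, K, mul_smul_comm, map_smul, Finset.mul_sum, map_sum]
    simp only [BoundedContinuousFunction.coe_smul, BoundedContinuousFunction.coe_sum,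
      Finset.sum_apply, smul_eq_mul]
    congr 1
    exact Finset.sum_congr rfl fun q _ => mul_comm _ _
  have hK : ∀ t, K t = ((((A.card : ℝ)⁻¹ * ‖∑ a ∈ A, e a (x - t)‖ ^ 2 : ℝ)) : ℂ) := by
    intro t
    simp only [K, BoundedContinuousFunction.coe_smul, BoundedContinuousFunction.coe_sum,
      Finset.sum_apply, smul_eq_mul]
    push_cast
    congr 1
    rw [← Complex.mul_conj', map_sum, Finset.sum_mul_sum, Finset.sum_product]
    refine Finset.sum_congr rfl fun a _ => Finset.sum_congr rfl fun b _ => ?_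
    simp only [e_apply, ← Complex.exp_conj]
    rw [← Complex.exp_add, ← Complex.exp_add]
    congr 1
    simp
    ring
  have hMK : M K = 1 := by
    simp only [K, map_smul, map_sum, M_e]
    rw [Finset.sum_product]
    simp only [sub_eq_zero, smul_eq_mul, mul_ite, mul_one, mul_zero]
    rw [Finset.sum_congr rfl (g := fun _ => (1 : ℂ))]
    · simp [hc]
    · intro a ha
      rw [Finset.sum_ite_eq' A a]
      simp [ha, e_apply]
  rw [h1]
  have := norm_M_le (F := f * K) (K := K) (C := ‖f‖) (by
    intro t
    simp only [BoundedContinuousFunction.coe_mul, Pi.mul_apply, norm_mul]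
    rw [hK t, Complex.ofReal_re, Complex.norm_of_nonneg (by positivity)]
    gcongr
    exact f.norm_coe_le_norm t)
  simpa [hMK] using this

lemma R_mem (A : Finset ℝ) {f : ℝ →ᵇ ℂ} (hf : ∀ a < 0, M (f * e (-a)) = 0) : R A f ∈ Sp := by
  rw [R_apply]
  refine Submodule.smul_mem _ _ (Submodule.sum_mem _ fun q _ => ?_)
  rcases lt_or_ge (q.1 - q.2) 0 with h | h
  · have := hf _ h
    rw [neg_sub] at this
    rw [this, zero_smul]; exact Submodule.zero_mem _
  · exact Submodule.smul_mem _ _ (Submodule.subset_span ⟨_, h, rfl⟩)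

lemma mem_closure_Sp {f : ℝ →ᵇ ℂ} (hf : ∀ a < 0, M (f * e (-a)) = 0)
    (hap : ∀ ε : ℝ, 0 < ε → ∃ (s : Finset ℝ) (c : ℝ → ℂ), ‖f - ∑ ω ∈ s, c ω • e ω‖ ≤ ε) :
    f ∈ closure (Sp : Set (ℝ →ᵇ ℂ)) := by
  rw [Metric.mem_closure_iff]
  intro ε hε
  obtain ⟨s, c, hp⟩ := hap (ε / 4) (by positivity)
  set p := ∑ ω ∈ s, c ω • e ω with hpdef
  set C := ∑ ω ∈ s, ‖c ω‖ with hC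
  have hC0 : 0 ≤ C := Finset.sum_nonneg fun _ _ => norm_nonneg _
  obtain ⟨A, hA, hAf⟩ := folner s (δ := ε / 4 / (C + 1)) (by positivity)
  refine ⟨R A f, R_mem A hf, ?_⟩
  have hcA : (0 : ℝ) < A.card := by exact_mod_cast hA.card_pos
  have hpR : ‖p - R A p‖ ≤ ε / 4 := by
    have : p - R A p = ∑ ω ∈ s, c ω • (e ω - R A (e ω)) := by
      simp only [hpdef, map_sum, map_smul, smul_sub, Finset.sum_sub_distrib]
    rw [this]
    have hb : ∀ ω ∈ s, ‖c ω • (e ω - R A (e ω))‖ ≤ ‖c ω‖ * (ε / 4 / (C + 1)) := by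
      intro ω hω
      rw [norm_smul]
      gcongr
      set N := ((A ×ˢ A).filter fun q => q.1 - q.2 = ω).card with hN
      have h1 : e ω - R A (e ω) = ((1 - (A.card : ℝ)⁻¹ * N : ℝ) : ℂ) • e ω := by
        rw [R_e, ← hN]; push_cast; rw [sub_smul, one_smul]
      have hNle : N ≤ A.card := by
        refine Finset.card_le_card_of_injOn (fun q => q.1) ?_ ?_
        · intro q hq
          simp only [Finset.coe_filter, Finset.mem_product, Set.mem_ofPred_eq] at hq
          exact hq.1.1
        · intro q hq r hr hqr
          simp only [Finset.coe_filter, Finset.mem_product, Set.mem_ofPred_eq] at hq hr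
          have h3 := hq.2
          have h4 := hr.2
          have h5 : q.1 = r.1 := hqr
          exact Prod.ext h5 (by linarith)
      have hNle' : (N : ℝ) ≤ A.card := by exact_mod_cast hNle
      have h2 : (A.card : ℝ)⁻¹ * N ≤ 1 := by
        rw [inv_mul_le_iff₀ hcA]; simpa using hNle'
      have h3 : 1 - ε / 4 / (C + 1) ≤ (A.card : ℝ)⁻¹ * N := by
        rw [le_inv_mul_iff₀ hcA, mul_comm]; exact hAf ω hω
      rw [h1, norm_smul, Complex.norm_of_nonneg (by linarith)]
      calc _ ≤ (1 - (A.card : ℝ)⁻¹ * N) * 1 :=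
            mul_le_mul_of_nonneg_left (norm_e_le ω) (by linarith)
        _ ≤ _ := by linarith
    refine (norm_sum_le_of_le _ hb).trans ?_
    rw [← Finset.sum_mul, ← hC]
    rw [mul_div_assoc', div_le_iff₀ (by positivity)]
    nlinarith
  have hdec : f - R A f = (f - p) - R A (f - p) + (p - R A p) := by
    rw [map_sub]; abel
  rw [dist_eq_norm, hdec]
  have := norm_R_le hA (f - p)
  calc _ ≤ ‖f - p‖ + ‖R A (f - p)‖ + ‖p - R A p‖ :=
        (norm_add_le _ _).trans (add_le_add_left (norm_sub_le _ _) _)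
    _ < ε := by linarith

lemma exists_bcf {h : ℝ → ℂ} (hh : IsHU h) :
    ∃ f : ℝ →ᵇ ℂ, (∀ x, f x = h x) ∧ f ∈ closure (Sp : Set (ℝ →ᵇ ℂ)) := by
  obtain ⟨⟨hc, hap⟩, hsp⟩ := hh
  have htrig : ∀ (s : Finset ℝ) (c : ℝ → ℂ) (x : ℝ),
      (∑ ω ∈ s, c ω • e ω) x = ∑ ω ∈ s, c ω * Complex.exp (Complex.I * ω * x) := by
    intro s c x
    simp only [BoundedContinuousFunction.coe_smul, BoundedContinuousFunction.coe_sum,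
      Finset.sum_apply, smul_eq_mul, e_apply]
  obtain ⟨C, hC⟩ : ∃ C, ∀ x, ‖h x‖ ≤ C := by
    obtain ⟨p, ⟨s, c, hp⟩, hb⟩ := hap 1 one_pos
    refine ⟨1 + ‖∑ ω ∈ s, c ω • e ω‖, fun x => ?_⟩
    have h1 := (∑ ω ∈ s, c ω • e ω).norm_coe_le_norm x
    rw [htrig, ← hp] at h1
    have h2 := hb x
    calc ‖h x‖ = ‖(h x - p x) + p x‖ := by rw [sub_add_cancel]
      _ ≤ ‖h x - p x‖ + ‖p x‖ := norm_add_le _ _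
      _ ≤ _ := by linarith
  refine ⟨BoundedContinuousFunction.ofNormedAddCommGroup h hc C hC, fun x => rfl, ?_⟩
  apply mem_closure_Sp
  · intro a ha
    apply M_eq
    have := hsp a ha
    unfold BohrCoeffZero at this
    refine this.congr fun L => ?_
    unfold avg
    congr 2
    ext t
    simp only [BoundedContinuousFunction.coe_mul, Pi.mul_apply, e_apply,
      BoundedContinuousFunction.coe_ofNormedAddCommGroup]
    congr 2
    push_cast; ring
  · intro ε hε
    obtain ⟨p, ⟨s, c, hp⟩, hb⟩ := hap ε hε
    refine ⟨s, c, ?_⟩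
    rw [BoundedContinuousFunction.norm_le hε.le]
    intro x
    rw [BoundedContinuousFunction.coe_sub, Pi.sub_apply, htrig, ← hp]
    exact (hb x).le

lemma lower_bound (Λ : (ℝ →ᵇ ℂ) →L[ℂ] ℂ)
    (hΛ : ∀ a b : ℝ, 0 ≤ a → 0 ≤ b → Λ (e (a + b)) = Λ (e a) * Λ (e b))
    (hΛ1 : Λ (e 0) = 1) (hΛn : ∀ f, ‖Λ f‖ ≤ ‖f‖)
    {f g : ℝ →ᵇ ℂ} (hf : f ∈ closure (Sp : Set (ℝ →ᵇ ℂ))) (hg : g ∈ closure (Sp : Set (ℝ →ᵇ ℂ)))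
    (hfg : f * g = 1) : 0 < ‖g‖⁻¹ ∧ ‖g‖⁻¹ ≤ ‖Λ f‖ := by
  have h1 := mult_of_mem_closure Λ hΛ hf hg
  rw [hfg, ← e_zero, hΛ1] at h1
  have hg0 : g ≠ 0 := by
    rintro rfl
    simp at h1
  have hpos : 0 < ‖g‖ := norm_pos_iff.2 hg0
  refine ⟨inv_pos.2 hpos, ?_⟩
  rw [inv_le_iff_one_le_mul₀ hpos]
  have h2 : (1 : ℝ) = ‖Λ f‖ * ‖Λ g‖ := by rw [← norm_mul, ← h1, norm_one]
  rw [h2]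
  exact mul_le_mul_of_nonneg_left (hΛn g) (norm_nonneg _)

/-- Poisson kernel -/
noncomputable def P (y s : ℝ) : ℝ := y / (Real.pi * (s ^ 2 + y ^ 2))

lemma P_eq {y : ℝ} (hy : 0 < y) : P y = ProbabilityTheory.cauchyPDFReal 0 y.toNNReal := by
  ext s
  rw [ProbabilityTheory.cauchyPDFReal_def]
  simp only [Real.coe_toNNReal y hy.le, sub_zero, P]
  have : s ^ 2 + y ^ 2 ≠ 0 := by positivity
  field_simp

lemma integrable_P {y : ℝ} (hy : 0 < y) : Integrable (P y) := by
  rw [P_eq hy]; exact ProbabilityTheory.integrable_cauchyPDFReal _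

lemma integral_P {y : ℝ} (hy : 0 < y) : ∫ s, P y s = 1 := by
  rw [P_eq hy]; exact ProbabilityTheory.integral_cauchyPDFReal_eq_one _ (by
    simpa using hy)

lemma P_nonneg {y : ℝ} (hy : 0 < y) (s : ℝ) : 0 ≤ P y s := by unfold P; positivity

open FourierTransform in
lemma fourier_P {y : ℝ} (hy : 0 < y) {ω : ℝ} (hω : 0 ≤ ω) :
    ∫ s : ℝ, P y s • Complex.exp (-(Complex.I * ω * s)) = Complex.exp (-(ω * y)) := by
  let f : ℝ → ℂ := fun v => Complex.exp (-(2 * Real.pi * y * |v|))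
  have hfc : Continuous f := by
    simp only [f]; fun_prop
  have hpi := Real.pi_pos
  have hA : ∀ w : ℝ, IntegrableOn (fun v : ℝ => Complex.exp (↑(-2 * Real.pi * v * w) * Complex.I) • f v) (Set.Iic 0)
      ∧ ∫ v in Set.Iic (0:ℝ), Complex.exp (↑(-2 * Real.pi * v * w) * Complex.I) • f v
        = 1 / (2 * Real.pi * (y - Complex.I * w)) := by
    intro w
    have ha : 0 < (2 * Real.pi * (y - Complex.I * w) : ℂ).re := by
      simp; positivity
    have heq : Set.EqOn (fun v : ℝ => Complex.exp ((2 * Real.pi * (y - Complex.I * w) : ℂ) * v))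
        (fun v : ℝ => Complex.exp (↑(-2 * Real.pi * v * w) * Complex.I) • f v) (Set.Iic 0) := by
      intro v hv
      have hv' : |v| = -v := abs_of_nonpos hv
      simp only [f, smul_eq_mul, hv']
      rw [← Complex.exp_add]
      congr 1; push_cast; ring
    constructor
    · exact (integrableOn_exp_mul_complex_Iic ha 0).congr_fun heq measurableSet_Iic
    · rw [← setIntegral_congr_fun measurableSet_Iic heq, integral_exp_mul_complex_Iic ha 0]
      simp
  have hB : ∀ w : ℝ, IntegrableOn (fun v : ℝ => Complex.exp (↑(-2 * Real.pi * v * w) * Complex.I) • f v) (Set.Ioi 0)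
      ∧ ∫ v in Set.Ioi (0:ℝ), Complex.exp (↑(-2 * Real.pi * v * w) * Complex.I) • f v
        = 1 / (2 * Real.pi * (y + Complex.I * w)) := by
    intro w
    have ha : (-(2 * Real.pi * (y + Complex.I * w)) : ℂ).re < 0 := by
      simp; positivity
    have heq : Set.EqOn (fun v : ℝ => Complex.exp ((-(2 * Real.pi * (y + Complex.I * w)) : ℂ) * v))
        (fun v : ℝ => Complex.exp (↑(-2 * Real.pi * v * w) * Complex.I) • f v) (Set.Ioi 0) := by
      intro v hv
      have hv' : |v| = v := abs_of_pos hv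
      simp only [f, smul_eq_mul, hv']
      rw [← Complex.exp_add]
      congr 1; push_cast; ring
    constructor
    · exact (integrableOn_exp_mul_complex_Ioi ha 0).congr_fun heq measurableSet_Ioi
    · rw [← setIntegral_congr_fun measurableSet_Ioi heq, integral_exp_mul_complex_Ioi ha 0]
      simp [neg_div_neg_eq]
  have hfi : Integrable f := by
    have h1 := (hA 0).1
    have h2 := (hB 0).1
    have h3 := h1.union h2
    rw [Set.Iic_union_Ioi, integrableOn_univ] at h3
    simpa using h3
  have hF : 𝓕 f = fun w => ((P y w : ℝ) : ℂ) := by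
    ext w
    rw [Real.fourier_real_eq_integral_exp_smul]
    have h3 := (hA w).1.union (hB w).1
    rw [Set.Iic_union_Ioi, integrableOn_univ] at h3
    rw [← intervalIntegral.integral_Iic_add_Ioi (hA w).1 (hB w).1, (hA w).2, (hB w).2]
    have e1 : (y - Complex.I * w : ℂ) ≠ 0 := fun h => hy.ne' (by simpa using congrArg Complex.re h)
    have e2 : (y + Complex.I * w : ℂ) ≠ 0 := fun h => hy.ne' (by simpa using congrArg Complex.re h)
    have e3 : (w ^ 2 + y ^ 2 : ℂ) = (y - Complex.I * w) * (y + Complex.I * w) := by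
      ring_nf; simp
    have e4 : (Real.pi : ℂ) ≠ 0 := by exact_mod_cast hpi.ne'
    unfold P
    push_cast
    rw [e3]
    field_simp
    ring
  have hFi : Integrable (𝓕 f) := by
    rw [hF]; exact (integrable_P hy).ofReal
  have hinv := congrFun (hfc.fourierInv_fourier_eq hfi hFi) (-(ω / (2 * Real.pi)))
  rw [hF, Real.fourierInv_eq'] at hinv
  have habs : |(-(ω / (2 * Real.pi)))| = ω / (2 * Real.pi) := by
    rw [abs_neg, abs_of_nonneg (by positivity)]
  have e4 : (Real.pi : ℂ) ≠ 0 := by exact_mod_cast hpi.ne'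
  simp only [f, habs] at hinv
  convert hinv using 1
  · congr 1
    ext s
    rw [Complex.real_smul, smul_eq_mul, mul_comm]
    congr 2
    simp
    field_simp
  · congr 1
    push_cast
    field_simp

lemma norm_pois_aux (x : ℝ) {y : ℝ} (hy : 0 < y) (f : ℝ →ᵇ ℂ) :
    ‖∫ s, P y s • f (x - s)‖ ≤ ‖f‖ := by
  have h := norm_integral_le_of_norm_le (f := fun s => P y s • f (x - s))
    (g := fun s => P y s * ‖f‖) ((integrable_P hy).mul_const _)
    (Filter.Eventually.of_forall fun s => by
      rw [norm_smul, Real.norm_of_nonneg (P_nonneg hy s)]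
      exact mul_le_mul_of_nonneg_left (f.norm_coe_le_norm _) (P_nonneg hy s))
  rw [integral_mul_const, integral_P hy] at h
  simpa using h

/-- Poisson integral functional -/
noncomputable def Pois (x : ℝ) {y : ℝ} (hy : 0 < y) : (ℝ →ᵇ ℂ) →L[ℂ] ℂ :=
  have hint : ∀ f : ℝ →ᵇ ℂ, Integrable fun s => P y s • f (x - s) := fun f => by
    refine Integrable.mono' ((integrable_P hy).mul_const ‖f‖) ?_ ?_
    · have := f.continuous
      exact (integrable_P hy).aestronglyMeasurable.smul
        (Continuous.aestronglyMeasurable (by fun_prop))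
    · exact Filter.Eventually.of_forall fun s => by
        rw [norm_smul, Real.norm_of_nonneg (P_nonneg hy s)]
        exact mul_le_mul_of_nonneg_left (f.norm_coe_le_norm _) (P_nonneg hy s)
  LinearMap.mkContinuous
    { toFun := fun f => ∫ s, P y s • f (x - s)
      map_add' := fun f g => by
        rw [← integral_add (hint f) (hint g)]
        simp
      map_smul' := fun c f => by
        rw [RingHom.id_apply, ← integral_smul]
        congr 1; ext s
        simp only [BoundedContinuousFunction.coe_smul]
        rw [smul_comm] } 1 (fun f => by
    rw [one_mul]; exact norm_pois_aux x hy f)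

lemma Pois_apply (x : ℝ) {y : ℝ} (hy : 0 < y) (f : ℝ →ᵇ ℂ) :
    Pois x hy f = ∫ s, P y s • f (x - s) := rfl

lemma norm_Pois_le (x : ℝ) {y : ℝ} (hy : 0 < y) (f : ℝ →ᵇ ℂ) : ‖Pois x hy f‖ ≤ ‖f‖ :=
  norm_pois_aux x hy f

lemma Pois_e (x : ℝ) {y : ℝ} (hy : 0 < y) {ω : ℝ} (hω : 0 ≤ ω) :
    Pois x hy (e ω) = Complex.exp (Complex.I * ω * x) * Complex.exp (-(ω * y)) := by
  rw [Pois_apply, ← fourier_P hy hω, ← integral_const_mul]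
  congr 1; ext s
  rw [mul_smul_comm, ← Complex.exp_add, e_apply]
  congr 2; push_cast; ring

/-- evaluation -/
noncomputable def ev (x : ℝ) : (ℝ →ᵇ ℂ) →L[ℂ] ℂ := BoundedContinuousFunction.evalCLM ℂ x

lemma main_bound {f g : ℝ →ᵇ ℂ} (hf : f ∈ closure (Sp : Set (ℝ →ᵇ ℂ)))
    (hg : g ∈ closure (Sp : Set (ℝ →ᵇ ℂ))) (hfg : f * g = 1) (h : ℝ → ℂ) (hfh : ∀ x, f x = h x)
    (z : ℂ) (hz : 0 ≤ z.im) : ‖g‖⁻¹ ≤ ‖poissonExt h z‖ := by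
  unfold poissonExt
  split_ifs with h0
  · have := (lower_bound (ev z.re) (fun a b _ _ => by
      rw [← e_mul]; rfl) (by rw [e_zero]; rfl) (fun f => f.norm_coe_le_norm _) hf hg hfg).2
    rw [← hfh]; exact this
  · have hy : 0 < z.im := lt_of_le_of_ne hz (Ne.symm h0)
    have := (lower_bound (Pois z.re hy) (fun a b ha hb => by
      rw [Pois_e _ hy ha, Pois_e _ hy hb, Pois_e _ hy (add_nonneg ha hb)]
      simp only [← Complex.exp_add]
      congr 1; push_cast; ring) (by rw [Pois_e _ hy le_rfl]; simp) (norm_Pois_le _ hy) hf hg hfg).2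
    rw [Pois_apply] at this
    simp only [hfh] at this
    exact this

end IHU
end

/-- If `h ∈ IHU(ℝ)` (i.e. `h` and `h⁻¹` are almost periodic with spectrum in `[0,∞)`),
then the mean `ĥ(0) = m(h)` is nonzero, the Poisson extension of `h` has no zeros in the
closed upper half-plane, and `|H|` is bounded below there by a positive constant. -/
theorem ihu_poisson_no_zeros (h g : ℝ → ℂ) (hh : IsHU h) (hg : IsHU g)
    (hinv : ∀ x : ℝ, h x * g x = 1) :
    (∀ m₀ : ℂ, Tendsto (fun L : ℝ => (2 * L)⁻¹ • ∫ t in (-L)..L, h t)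
        atTop (nhds m₀) → m₀ ≠ 0) ∧
    (∀ z : ℂ, 0 ≤ z.im → poissonExt h z ≠ 0) ∧
    (∃ c : ℝ, 0 < c ∧ ∀ z : ℂ, 0 ≤ z.im → c ≤ ‖poissonExt h z‖) := by
  obtain ⟨f, hf, hfS⟩ := IHU.exists_bcf hh
  obtain ⟨k, hk, hkS⟩ := IHU.exists_bcf hg
  have hfk : f * k = 1 := by
    ext x
    simp [hf, hk, hinv]
  have hM := IHU.lower_bound IHU.M (fun a b ha hb => by
    simp only [IHU.M_e]
    by_cases h1 : a = 0
    · simp [h1]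
    · have : a + b ≠ 0 := by
        have := lt_of_le_of_ne ha (Ne.symm h1)
        positivity
      simp [h1, this]) (by simp [IHU.M_e]) IHU.norm_M_le_norm hfS hkS hfk
  have hb := IHU.main_bound hfS hkS hfk h hf
  refine ⟨?_, ?_, ⟨_, hM.1, hb⟩⟩
  · intro m₀ hm h0
    have : IHU.M f = m₀ := IHU.M_eq (by
      unfold IHU.avg
      simpa only [hf] using hm)
    have h2 := hM.2
    rw [this, h0, norm_zero] at h2
    exact absurd hM.1 (not_lt.2 h2)
  · intro z hz h0
    have h2 := hb z hz
    rw [h0, norm_zero] at h2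
    exact absurd hM.1 (not_lt.2 h2)
end

section
/- Let h \in U(\mathbb{R}) be uniformly almost periodic. Its Poisson integral H(x+iy) = (P_y * h)(x) is continuous on the closed upper half-plane, harmonic on the open upper half-plane, satisfies \lim_{y\to\infty} \sup_{x \in \mathbb{R}} |H(x+iy) - m(h)| = 0, and H is holomorphic on the open upper half-plane if and only if \Omega(h) \subseteq [0,\infty). -/
open Complex Filter Metric

/-- A complex-valued function is harmonic on an (open) set `U` if near every point it is the
sum of a holomorphic function and the conjugate of a holomorphic function. -/
def IsHarmonicOn (H : ℂ → ℂ) (U : Set ℂ) : Prop :=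
  ∀ z ∈ U, ∃ ε : ℝ, 0 < ε ∧ ∃ F G : ℂ → ℂ,
    DifferentiableOn ℂ F (ball z ε) ∧ DifferentiableOn ℂ G (ball z ε) ∧
    ∀ w ∈ ball z ε, H w = F w + starRingEnd ℂ (G w)


open MeasureTheory

namespace UAPP

lemma integrable_base (x y : ℝ) (hy : y ≠ 0) :
    Integrable (fun t : ℝ => ((t - x) ^ 2 + y ^ 2)⁻¹) := by
  have h1 := (integrable_inv_one_add_sq.comp_div hy).const_mul (y ^ 2)⁻¹
  have h2 := h1.comp_sub_right x
  refine h2.congr (Filter.Eventually.of_forall fun t => ?_)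
  simp only
  rw [← mul_inv]
  congr 1
  field_simp
  ring

lemma sub_ne {z : ℂ} (hz : z.im ≠ 0) (t : ℝ) : (t : ℂ) - z ≠ 0 := by
  intro h
  have := congrArg Complex.im h
  simp at this
  exact hz this

lemma cont_inv {z : ℂ} (hz : z.im ≠ 0) : Continuous (fun t : ℝ => ((t : ℂ) - z)⁻¹) :=
  (by fun_prop : Continuous (fun t : ℝ => (t : ℂ) - z)).inv₀ (sub_ne hz)

lemma norm_sub_sq (z : ℂ) (t : ℝ) : ‖(t : ℂ) - z‖ ^ 2 = (t - z.re) ^ 2 + z.im ^ 2 := by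
  rw [← Complex.normSq_eq_norm_sq, Complex.normSq_apply]
  simp
  ring

lemma integrable_nsq {z : ℂ} (hz : z.im ≠ 0) :
    Integrable (fun t : ℝ => ‖((t : ℂ) - z)⁻¹‖ ^ 2) := by
  refine (integrable_base z.re z.im hz).congr (Filter.Eventually.of_forall fun t => ?_)
  simp only [norm_inv, inv_pow, norm_sub_sq]

lemma pk_integrable {y : ℝ} (hy : 0 < y) :
    Integrable (fun s : ℝ => y / (Real.pi * (s ^ 2 + y ^ 2))) := by
  refine ((integrable_base 0 y hy.ne').const_mul (y / Real.pi)).congr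
    (Filter.Eventually.of_forall fun t => ?_)
  simp only [sub_zero]
  field_simp

lemma pk_nonneg {y : ℝ} (hy : 0 < y) (s : ℝ) : 0 ≤ y / (Real.pi * (s ^ 2 + y ^ 2)) := by
  positivity

open FourierTransform in
lemma fourier_exp_abs {y : ℝ} (hy : 0 < y) (w : ℝ) :
    𝓕 (fun v : ℝ => Complex.exp (-(2 * Real.pi * y * |v|))) w
      = ((y / (Real.pi * (w ^ 2 + y ^ 2)) : ℝ) : ℂ) := by
  have hpi := Real.pi_pos
  rw [Real.fourier_eq']
  set a : ℂ := 2 * Real.pi * (-y - w * I) with ha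
  set b : ℂ := 2 * Real.pi * (y - w * I) with hb
  have har : a.re < 0 := by
    have : 0 < 2 * Real.pi * y := by positivity
    simp [ha]; linarith
  have hbr : 0 < b.re := by
    have : 0 < 2 * Real.pi * y := by positivity
    simp [hb]; linarith
  have e1 : ∀ v ∈ Set.Ioi (0:ℝ), Complex.exp (↑(-2 * Real.pi * inner ℝ v w) * I) • Complex.exp (-(2 * Real.pi * y * |v|)) = Complex.exp (a * v) := by
    intro v hv
    rw [abs_of_pos hv, smul_eq_mul, ← Complex.exp_add]
    congr 1
    simp [ha]; ring
  have e2 : ∀ v ∈ Set.Iic (0:ℝ), Complex.exp (↑(-2 * Real.pi * inner ℝ v w) * I) • Complex.exp (-(2 * Real.pi * y * |v|)) = Complex.exp (b * v) := by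
    intro v hv
    rw [abs_of_nonpos hv, smul_eq_mul, ← Complex.exp_add]
    congr 1
    simp [hb]; ring
  have i1 := (integrableOn_congr_fun e1 measurableSet_Ioi).2 (integrableOn_exp_mul_complex_Ioi har 0)
  have i2 := (integrableOn_congr_fun e2 measurableSet_Iic).2 (integrableOn_exp_mul_complex_Iic hbr 0)
  rw [← intervalIntegral.integral_Iic_add_Ioi i2 i1, setIntegral_congr_fun measurableSet_Ioi e1,
    setIntegral_congr_fun measurableSet_Iic e2, integral_exp_mul_complex_Ioi har,
    integral_exp_mul_complex_Iic hbr]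
  have ha0 : a ≠ 0 := by intro h; rw [h] at har; simp at har
  have hb0 : b ≠ 0 := by intro h; rw [h] at hbr; simp at hbr
  have hpc : (Real.pi : ℂ) ≠ 0 := by exact_mod_cast hpi.ne'
  have hs : ((w:ℂ) ^ 2 + (y:ℂ) ^ 2) ≠ 0 := by
    have : 0 < w ^ 2 + y ^ 2 := by positivity
    exact_mod_cast this.ne'
  have hab : a * b = -(4 * Real.pi ^ 2 * (w ^ 2 + y ^ 2)) := by
    rw [ha, hb]; ring_nf; simp; ring
  have hba : a - b = - (4 * Real.pi * y) := by rw [ha, hb]; ring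
  have : Complex.exp (b * (0:ℝ)) / b + -Complex.exp (a * (0:ℝ)) / a = (a - b) / (a * b) := by
    simp; field_simp; ring
  rw [this, hab, hba]
  push_cast
  field_simp

open FourierTransform in
lemma pk_fourier {y : ℝ} (hy : 0 < y) (ω : ℝ) :
    ∫ s : ℝ, (y / (Real.pi * (s ^ 2 + y ^ 2))) • Complex.exp (-(I * ω * s))
      = Complex.exp (-(|ω| * y)) := by
  have hpi := Real.pi_pos
  set f : ℝ → ℂ := fun v : ℝ => Complex.exp (-(2 * Real.pi * y * |v|)) with hf
  have hF : 𝓕 f = fun w : ℝ => ((y / (Real.pi * (w ^ 2 + y ^ 2)) : ℝ) : ℂ) :=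
    funext (fourier_exp_abs hy)
  have hc : Continuous f := by rw [hf]; fun_prop
  have hi : Integrable f := by
    have p : 0 < 2 * Real.pi * y := by positivity
    rw [← integrableOn_univ, ← Set.Iic_union_Ioi (a := (0:ℝ)), integrableOn_union]
    constructor
    · refine (integrableOn_congr_fun (fun v hv => ?_) measurableSet_Iic).2
        (integrableOn_exp_mul_complex_Iic (a := ((2 * Real.pi * y : ℝ) : ℂ)) (by rw [ofReal_re]; exact p) 0)
      simp only [hf]
      rw [abs_of_nonpos hv]; congr 1; push_cast; ring
    · refine (integrableOn_congr_fun (fun v hv => ?_) measurableSet_Ioi).2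
        (integrableOn_exp_mul_complex_Ioi (a := ((-(2 * Real.pi * y) : ℝ) : ℂ)) (by rw [ofReal_re]; linarith) 0)
      simp only [hf]
      rw [abs_of_pos hv]; congr 1; push_cast; ring
  have hFi : Integrable (𝓕 f) := by rw [hF]; exact (pk_integrable hy).ofReal
  have h := congrFun (hc.fourierInv_fourier_eq hi hFi) (-ω / (2 * Real.pi))
  rw [hF, Real.fourierInv_eq'] at h
  have h2 : f (-ω / (2 * Real.pi)) = Complex.exp (-(|ω| * y)) := by
    simp only [hf]
    congr 1
    rw [abs_div, abs_neg, abs_of_pos (show 0 < 2 * Real.pi by positivity)]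
    have hpc : (Real.pi : ℂ) ≠ 0 := by exact_mod_cast hpi.ne'
    push_cast
    field_simp
  rw [← h2, ← h]
  congr 1
  ext s
  rw [smul_eq_mul, Complex.real_smul]
  have hpc : (Real.pi : ℂ) ≠ 0 := by exact_mod_cast hpi.ne'
  rw [mul_comm]
  congr 2
  simp
  field_simp

lemma pk_integral {y : ℝ} (hy : 0 < y) :
    ∫ s : ℝ, (y / (Real.pi * (s ^ 2 + y ^ 2))) = 1 := by
  have := pk_fourier hy 0
  simp only [ofReal_zero, mul_zero, zero_mul, neg_zero, Complex.exp_zero, abs_zero,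
    Complex.real_smul, mul_one] at this
  rw [integral_complex_ofReal] at this
  exact_mod_cast this

/-- bounded -/
def Bdd (f : ℝ → ℂ) : Prop := ∃ C, ∀ x, ‖f x‖ ≤ C

lemma int_mul {k f : ℝ → ℂ} (hk : Integrable k) (hf : Continuous f) (hb : Bdd f) :
    Integrable (fun t => k t * f t) := by
  obtain ⟨C, hC⟩ := hb
  refine (hk.norm.mul_const C).mono' (hk.1.mul hf.aestronglyMeasurable)
    (Filter.Eventually.of_forall fun t => ?_)
  rw [norm_mul]
  exact mul_le_mul_of_nonneg_left (hC t) (norm_nonneg _)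

lemma int_smul {k : ℝ → ℝ} {f : ℝ → ℂ} (hk : Integrable k) (hf : Continuous f) (hb : Bdd f) :
    Integrable (fun t => k t • f t) := by
  simp only [Complex.real_smul]
  exact int_mul hk.ofReal hf hb

lemma norm_e (ω x : ℝ) : ‖Complex.exp (I * ω * x)‖ = 1 := by
  rw [show I * (ω:ℂ) * x = ((ω * x : ℝ) : ℂ) * I by push_cast; ring]
  exact Complex.norm_exp_ofReal_mul_I _

lemma trig_cont {p : ℝ → ℂ} (hp : IsTrigPoly p) : Continuous p := by
  obtain ⟨s, c, h⟩ := hp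
  rw [funext h]
  fun_prop

lemma trig_bdd {p : ℝ → ℂ} (hp : IsTrigPoly p) : Bdd p := by
  obtain ⟨s, c, h⟩ := hp
  refine ⟨∑ ω ∈ s, ‖c ω‖, fun x => ?_⟩
  rw [h]
  refine (norm_sum_le _ _).trans (Finset.sum_le_sum fun ω _ => ?_)
  rw [norm_mul, norm_e, mul_one]

lemma uap_bdd {h : ℝ → ℂ} (hh : IsUAP h) : Bdd h := by
  obtain ⟨p, hp, hlt⟩ := hh.2 1 one_pos
  obtain ⟨C, hC⟩ := trig_bdd hp
  refine ⟨1 + C, fun x => ?_⟩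
  calc ‖h x‖ = ‖(h x - p x) + p x‖ := by simp
    _ ≤ _ := (norm_add_le _ _).trans (add_le_add (hlt x).le (hC x))

lemma poisson_close {h g : ℝ → ℂ} (hc : Continuous h) (hb : Bdd h) (gc : Continuous g) (gb : Bdd g)
    {ε : ℝ} (hε : ∀ x, ‖h x - g x‖ ≤ ε) {z : ℂ} (hz : 0 ≤ z.im) :
    ‖poissonExt h z - poissonExt g z‖ ≤ ε := by
  unfold poissonExt
  split_ifs with h0
  · exact hε _
  · have hy : 0 < z.im := lt_of_le_of_ne hz (Ne.symm h0)
    have sh : ∀ {f : ℝ → ℂ}, Continuous f → Bdd f →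
        Continuous (fun s => f (z.re - s)) ∧ Bdd (fun s => f (z.re - s)) := by
      intro f hf ⟨C, hC⟩
      exact ⟨by fun_prop, C, fun x => hC _⟩
    rw [← integral_sub (int_smul (pk_integrable hy) (sh hc hb).1 (sh hc hb).2)
      (int_smul (pk_integrable hy) (sh gc gb).1 (sh gc gb).2)]
    calc _ ≤ ∫ s : ℝ, (z.im / (Real.pi * (s ^ 2 + z.im ^ 2))) * ε := by
          refine norm_integral_le_of_norm_le ((pk_integrable hy).mul_const ε)
            (Filter.Eventually.of_forall fun s => ?_)
          rw [← smul_sub, norm_smul, Real.norm_of_nonneg (pk_nonneg hy s)]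
          exact mul_le_mul_of_nonneg_left (hε _) (pk_nonneg hy s)
      _ = ε := by rw [integral_mul_const, pk_integral hy, one_mul]

lemma poisson_trig {p : ℝ → ℂ} {s : Finset ℝ} {c : ℝ → ℂ}
    (hp : ∀ x : ℝ, p x = ∑ ω ∈ s, c ω * Complex.exp (Complex.I * ω * x)) {z : ℂ} (hz : 0 ≤ z.im) :
    poissonExt p z = ∑ ω ∈ s, c ω * Complex.exp (I * ω * z.re - |ω| * z.im) := by
  unfold poissonExt
  split_ifs with h0
  · rw [hp, h0]; simp
  · have hy : 0 < z.im := lt_of_le_of_ne hz (Ne.symm h0)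
    have e : ∀ t : ℝ, (z.im / (Real.pi * (t ^ 2 + z.im ^ 2))) • p (z.re - t)
        = ∑ ω ∈ s, (c ω * Complex.exp (I * ω * z.re)) *
          ((z.im / (Real.pi * (t ^ 2 + z.im ^ 2))) • Complex.exp (-(I * ω * t))) := by
      intro t
      rw [hp, Finset.smul_sum]
      refine Finset.sum_congr rfl fun ω _ => ?_
      rw [show I * (ω:ℂ) * ((z.re - t : ℝ) : ℂ) = I * ω * z.re + -(I * ω * t) by push_cast; ring,
        Complex.exp_add, Complex.real_smul, Complex.real_smul]
      ring
    simp_rw [e]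
    rw [integral_finsetSum]
    · refine Finset.sum_congr rfl fun ω _ => ?_
      rw [integral_const_mul, pk_fourier hy, mul_assoc, ← Complex.exp_add]
      congr 2
    · intro ω _
      refine Integrable.const_mul (int_smul (pk_integrable hy) (by fun_prop) ⟨1, fun x => ?_⟩) _
      have := norm_e (-ω) x
      rw [← this]
      apply le_of_eq; congr 2; push_cast; ring

lemma part1 {h : ℝ → ℂ} (hh : IsUAP h) : ContinuousOn (poissonExt h) {z : ℂ | 0 ≤ z.im} := by
  have : ∀ n : ℕ, ∃ p : ℝ → ℂ, IsTrigPoly p ∧ ∀ x : ℝ, ‖h x - p x‖ < 1 / ((n:ℝ) + 1) :=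
    fun n => hh.2 _ (by positivity)
  choose p hp hlt using this
  have hu : TendstoUniformlyOn (fun n => poissonExt (p n)) (poissonExt h) atTop {z : ℂ | 0 ≤ z.im} := by
    rw [Metric.tendstoUniformlyOn_iff]
    intro ε hε
    have := (tendsto_one_div_add_atTop_nhds_zero_nat (𝕜 := ℝ)).eventually (gt_mem_nhds hε)
    filter_upwards [this] with n hn z hz
    rw [dist_eq_norm]
    exact (poisson_close hh.1 (uap_bdd hh) (trig_cont (hp n)) (trig_bdd (hp n))
      (fun x => (hlt n x).le) hz).trans_lt hn
  refine hu.continuousOn (Filter.Eventually.of_forall fun n => ?_).frequently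
  obtain ⟨s, c, hs⟩ := hp n
  refine ContinuousOn.congr (f := fun z : ℂ => ∑ ω ∈ s, c ω * Complex.exp (I * ω * z.re - |ω| * z.im)) ?_
    (fun z hz => poisson_trig hs hz)
  fun_prop

/-- mean -/
noncomputable def M (f : ℝ → ℂ) (L : ℝ) : ℂ := (2 * L)⁻¹ • ∫ t in (-L)..L, f t

lemma M_norm_le {f : ℝ → ℂ} {C : ℝ} (h : ∀ x, ‖f x‖ ≤ C) {L : ℝ} (hL : 0 < L) : ‖M f L‖ ≤ C := by
  unfold M
  have := intervalIntegral.norm_integral_le_of_norm_le_const (a := -L) (b := L) (f := f) (C := C)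
    (fun x _ => h x)
  rw [norm_smul, Real.norm_of_nonneg (by positivity)]
  rw [abs_of_pos (by linarith)] at this
  calc _ ≤ (2 * L)⁻¹ * (C * (L - -L)) := by gcongr
    _ = C := by field_simp; ring

lemma M_sub {f g : ℝ → ℂ} (hf : Continuous f) (hg : Continuous g) (L : ℝ) :
    M (fun x => f x - g x) L = M f L - M g L := by
  unfold M
  rw [intervalIntegral.integral_sub (hf.intervalIntegrable _ _) (hg.intervalIntegrable _ _), smul_sub]

lemma M_const_mul (a : ℂ) (f : ℝ → ℂ) (L : ℝ) : M (fun x => a * f x) L = a * M f L := by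
  unfold M
  rw [intervalIntegral.integral_const_mul, mul_smul_comm]

lemma M_sum {s : Finset ℝ} {f : ℝ → ℝ → ℂ} (hf : ∀ i, Continuous (f i)) (L : ℝ) :
    M (fun x => ∑ i ∈ s, f i x) L = ∑ i ∈ s, M (f i) L := by
  unfold M
  rw [intervalIntegral.integral_finsetSum (fun i _ => (hf i).intervalIntegrable _ _), Finset.smul_sum]

lemma M_e_ne {ω : ℝ} (hω : ω ≠ 0) :
    Tendsto (M (fun x => Complex.exp (I * ω * x))) atTop (nhds 0) := by
  have hI : I * (ω:ℂ) ≠ 0 := mul_ne_zero I_ne_zero (by exact_mod_cast hω)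
  have ht : Tendsto (fun L : ℝ => |ω|⁻¹ * L⁻¹) atTop (nhds 0) := by
    simpa using tendsto_inv_atTop_zero.const_mul (|ω|⁻¹)
  refine squeeze_zero_norm' ?_ ht
  filter_upwards [eventually_gt_atTop 0] with L hL
  unfold M
  rw [integral_exp_mul_complex hI, norm_smul, norm_div, norm_mul, Complex.norm_I, one_mul,
    Complex.norm_real, Real.norm_of_nonneg (by positivity), Real.norm_eq_abs]
  have : ‖Complex.exp (I * ω * (L:ℝ)) - Complex.exp (I * ω * ((-L : ℝ):ℂ))‖ ≤ 2 := by
    refine (norm_sub_le _ _).trans ?_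
    rw [norm_e, norm_e]; norm_num
  have hw : 0 < |ω| := abs_pos.2 hω
  calc _ ≤ (2 * L)⁻¹ * (2 / |ω|) := by gcongr
    _ = _ := by field_simp

lemma M_e_zero : Tendsto (M (fun x => Complex.exp (I * (0:ℝ) * x))) atTop (nhds 1) := by
  refine tendsto_const_nhds.congr' ?_
  filter_upwards [eventually_gt_atTop 0] with L hL
  unfold M
  simp
  have : (L:ℂ) ≠ 0 := by exact_mod_cast hL.ne'
  field_simp; ring

lemma part3 {h : ℝ → ℂ} (hh : IsUAP h) (m₀ : ℂ) (hm : Tendsto (M h) atTop (nhds m₀)) :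
    Tendsto (fun y : ℝ => ⨆ x : ℝ, ‖poissonExt h (x + y * Complex.I) - m₀‖) atTop (nhds 0) := by
  rw [Metric.tendsto_nhds]
  intro ε hε
  obtain ⟨p, hp, hlt⟩ := hh.2 (ε / 4) (by positivity)
  have hpc := trig_cont hp
  have hpb := trig_bdd hp
  obtain ⟨s, c, hs⟩ := hp
  let b : ℝ → ℂ := fun ω => if ω = 0 then c ω else 0
  have hMp : Tendsto (M p) atTop (nhds (∑ ω ∈ s, b ω)) := by
    have : M p = fun L => ∑ ω ∈ s, c ω * M (fun x => Complex.exp (I * ω * x)) L := by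
      ext L
      rw [funext hs, M_sum (f := fun ω x => c ω * Complex.exp (I * ω * x)) (by fun_prop)]
      simp_rw [M_const_mul]
    rw [this]
    refine tendsto_finsetSum _ fun ω _ => ?_
    by_cases h0 : ω = 0
    · subst h0; simpa [b] using M_e_zero.const_mul (c 0)
    · simpa [b, h0] using (M_e_ne h0).const_mul (c ω)
  have hmm : ‖m₀ - ∑ ω ∈ s, b ω‖ ≤ ε / 4 := by
    refine le_of_tendsto (hm.sub hMp).norm ?_
    filter_upwards [eventually_gt_atTop 0] with L hL
    rw [← M_sub hh.1 hpc]
    exact M_norm_le (fun x => (hlt x).le) hL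
  have hdec : Tendsto (fun y : ℝ => ∑ ω ∈ s, ‖c ω - b ω‖ * Real.exp (-(|ω| * y))) atTop (nhds 0) := by
    rw [show (0:ℝ) = ∑ ω ∈ s, 0 by simp]
    refine tendsto_finsetSum _ fun ω _ => ?_
    by_cases h0 : ω = 0
    · simp [b, h0]
    · have : Tendsto (fun y : ℝ => |ω| * y) atTop atTop :=
        tendsto_id.const_mul_atTop (abs_pos.2 h0)
      simpa using (Real.tendsto_exp_neg_atTop_nhds_zero.comp this).const_mul ‖c ω - b ω‖
  filter_upwards [hdec.eventually (gt_mem_nhds (show 0 < ε / 4 by positivity)), eventually_gt_atTop 0]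
    with y hy hy0
  have key : ∀ x : ℝ, ‖poissonExt h (x + y * I) - m₀‖ ≤ 3 * (ε / 4) := by
    intro x
    have hz : 0 ≤ ((x:ℂ) + y * I).im := by simp [hy0.le]
    have h1 := poisson_close hh.1 (uap_bdd hh) hpc hpb (fun x => (hlt x).le) hz
    have h2 : ‖poissonExt p (x + y * I) - ∑ ω ∈ s, b ω‖ ≤ ε / 4 := by
      rw [poisson_trig hs hz, ← Finset.sum_sub_distrib]
      refine (norm_sum_le _ _).trans (le_trans (Finset.sum_le_sum fun ω _ => ?_) hy.le)
      by_cases h0 : ω = 0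
      · simp [b, h0]
      · simp only [b, h0, if_false, sub_zero, norm_mul]
        apply mul_le_mul_of_nonneg_left _ (norm_nonneg _)
        rw [Complex.norm_exp]
        simp
    calc _ = ‖(poissonExt h (x + y * I) - poissonExt p (x + y * I)) +
          (poissonExt p (x + y * I) - ∑ ω ∈ s, b ω) - (m₀ - ∑ ω ∈ s, b ω)‖ := by congr 1; ring
      _ ≤ ε / 4 + ε / 4 + ε / 4 := (norm_sub_le _ _).trans (add_le_add ((norm_add_le _ _).trans (add_le_add h1 h2)) hmm)
      _ = _ := by ring
  rw [Real.dist_eq, sub_zero, abs_of_nonneg (Real.iSup_nonneg fun x => norm_nonneg _)]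
  exact (ciSup_le key).trans_lt (by linarith)

/-- Cauchy type integral -/
noncomputable def Phi (f : ℝ → ℂ) (c w : ℂ) : ℂ := ∫ t : ℝ, (((t : ℂ) - w)⁻¹ - ((t : ℂ) - c)⁻¹) * f t

lemma int_diff {c w : ℂ} (hc : c.im ≠ 0) (hw : w.im ≠ 0) :
    Integrable (fun t : ℝ => ((t : ℂ) - w)⁻¹ - ((t : ℂ) - c)⁻¹) := by
  refine (((integrable_nsq hw).add (integrable_nsq hc)).const_mul ‖w - c‖).mono'
    ((cont_inv hw).sub (cont_inv hc)).aestronglyMeasurable (Filter.Eventually.of_forall fun t => ?_)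
  have : ((t : ℂ) - w)⁻¹ - ((t : ℂ) - c)⁻¹ = (w - c) * (((t : ℂ) - w)⁻¹ * ((t : ℂ) - c)⁻¹) := by
    have h1 := sub_ne hw t
    have h2 := sub_ne hc t
    field_simp
    ring
  rw [this, norm_mul, norm_mul]
  apply mul_le_mul_of_nonneg_left _ (norm_nonneg _)
  simp only [Pi.add_apply]
  nlinarith [sq_nonneg (‖((t : ℂ) - w)⁻¹‖ - ‖((t : ℂ) - c)⁻¹‖), sq_nonneg ‖((t : ℂ) - w)⁻¹‖, sq_nonneg ‖((t : ℂ) - c)⁻¹‖]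

lemma int_sq {w : ℂ} (hw : w.im ≠ 0) : Integrable (fun t : ℝ => (((t : ℂ) - w)⁻¹) ^ 2) := by
  refine (integrable_nsq hw).mono' ((cont_inv hw).pow 2).aestronglyMeasurable
    (Filter.Eventually.of_forall fun t => ?_)
  rw [norm_pow]

lemma phi_deriv {f : ℝ → ℂ} (hf : Continuous f) (hb : Bdd f) {c w : ℂ} (hc : c.im ≠ 0) (hw : 0 < w.im) :
    HasDerivAt (Phi f c) (∫ t : ℝ, (((t : ℂ) - w)⁻¹) ^ 2 * f t) w := by
  obtain ⟨C, hC⟩ := id hb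
  have hC0 : 0 ≤ C := (norm_nonneg _).trans (hC 0)
  have key : ∀ t : ℝ, ∀ v ∈ ball w (w.im / 2), 0 < v.im ∧ ‖((t : ℂ) - v)⁻¹‖ ≤ 2 * ‖((t : ℂ) - w)⁻¹‖ := by
    intro t v hv
    rw [mem_ball, dist_eq_norm] at hv
    have him := (Complex.abs_im_le_norm (v - w)).trans_lt hv
    rw [Complex.sub_im, abs_lt] at him
    have hv0 : 0 < v.im := by linarith [him.1]
    refine ⟨hv0, ?_⟩
    have h1 : w.im ≤ ‖(t : ℂ) - w‖ := by
      have := Complex.abs_im_le_norm ((t : ℂ) - w)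
      simp at this
      exact (le_abs_self _).trans this
    have h2 : ‖(t : ℂ) - w‖ ≤ ‖(t : ℂ) - v‖ + ‖v - w‖ := by
      rw [show (t : ℂ) - w = ((t : ℂ) - v) + (v - w) by ring]; exact norm_add_le _ _
    have h3 : ‖(t : ℂ) - w‖ / 2 ≤ ‖(t : ℂ) - v‖ := by linarith
    have h4 : 0 < ‖(t : ℂ) - w‖ := hw.trans_le h1
    rw [norm_inv, norm_inv]
    calc _ ≤ (‖(t : ℂ) - w‖ / 2)⁻¹ := by gcongr
      _ = _ := by rw [inv_div]; rfl
  refine (hasDerivAt_integral_of_dominated_loc_of_deriv_le (𝕜 := ℂ)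
    (F := fun (w : ℂ) (t : ℝ) => (((t : ℂ) - w)⁻¹ - ((t : ℂ) - c)⁻¹) * f t)
    (F' := fun (w : ℂ) (t : ℝ) => (((t : ℂ) - w)⁻¹) ^ 2 * f t)
    (bound := fun t : ℝ => 4 * C * ‖((t : ℂ) - w)⁻¹‖ ^ 2)
    (ball_mem_nhds w (half_pos hw)) ?_ (int_mul (int_diff hc hw.ne') hf hb)
    (int_mul (int_sq hw.ne') hf hb).1 ?_ ((integrable_nsq hw.ne').const_mul _) ?_).2
  · filter_upwards [ball_mem_nhds w (half_pos hw)] with v hv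
    exact (int_mul (int_diff hc (key 0 v hv).1.ne') hf hb).1
  · refine Filter.Eventually.of_forall fun t v hv => ?_
    rw [norm_mul, norm_pow]
    have := (key t v hv).2
    calc _ ≤ (2 * ‖((t : ℂ) - w)⁻¹‖) ^ 2 * C := by gcongr; exact hC t
      _ = _ := by ring
  · refine Filter.Eventually.of_forall fun t v hv => ?_
    have hne := sub_ne (key t v hv).1.ne' t
    have h1 : HasDerivAt (fun v : ℂ => (t : ℂ) - v) (-1) v := by
      simpa using (hasDerivAt_id v).const_sub (t : ℂ)
    have h2 := ((h1.inv hne).sub_const (((t : ℂ) - c)⁻¹)).mul_const (f t)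
    have e : - -1 / ((t : ℂ) - v) ^ 2 * f t = (((t : ℂ) - v)⁻¹) ^ 2 * f t := by
      rw [neg_neg, one_div, inv_pow]
    rw [e] at h2
    exact h2

lemma poisson_decomp {h : ℝ → ℂ} (hc : Continuous h) (hb : Bdd h) {z : ℂ} (hz : 0 < z.im) :
    poissonExt h z = (2 * Real.pi * I)⁻¹ * Phi h I z
      + starRingEnd ℂ ((2 * Real.pi * I)⁻¹ * Phi (fun t => starRingEnd ℂ (h t)) (-I) z) := by
  have hcb : Bdd (fun t => starRingEnd ℂ (h t)) := by
    obtain ⟨C, hC⟩ := hb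
    exact ⟨C, fun x => by simpa using hC x⟩
  have hcc : Continuous (fun t => starRingEnd ℂ (h t)) := Complex.continuous_conj.comp hc
  unfold poissonExt
  rw [if_neg hz.ne']
  have := integral_sub_left_eq_self (fun t : ℝ => (z.im / (Real.pi * ((z.re - t) ^ 2 + z.im ^ 2))) • h t) volume z.re
  simp only [sub_sub_cancel] at this
  rw [this, map_mul, Phi, Phi, ← integral_conj, ← integral_const_mul, ← integral_const_mul,
    ← integral_add]
  · congr 1
    ext t
    have hpc : (Real.pi : ℂ) ≠ 0 := by exact_mod_cast Real.pi_pos.ne'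
    have h1 := sub_ne hz.ne' t
    have hz' : (starRingEnd ℂ z).im ≠ 0 := by simpa using hz.ne'
    have h2 := sub_ne hz' t
    have e1 : ((t : ℂ) - z) * ((t : ℂ) - starRingEnd ℂ z) = ((z.re - t) ^ 2 + z.im ^ 2 : ℝ) := by
      apply Complex.ext
      · rw [ofReal_re]; simp; ring
      · rw [ofReal_im]; simp; ring
    have e2 : z - starRingEnd ℂ z = 2 * z.im * I := by
      apply Complex.ext <;> simp; ring
    have e3 : ((t : ℂ) - z)⁻¹ - ((t : ℂ) - starRingEnd ℂ z)⁻¹ = (2 * z.im * I) / ((z.re - t) ^ 2 + z.im ^ 2 : ℝ) := by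
      rw [← e1, ← e2]; field_simp; ring
    have e4 : (2 * Real.pi * I)⁻¹ * ((2 * z.im * I) / ((z.re - t) ^ 2 + z.im ^ 2 : ℝ)) =
        ((z.im / (Real.pi * ((z.re - t) ^ 2 + z.im ^ 2)) : ℝ) : ℂ) := by
      have : (((z.re - t) ^ 2 + z.im ^ 2 : ℝ) : ℂ) ≠ 0 := by rw [← e1]; exact mul_ne_zero h1 h2
      push_cast at this ⊢
      field_simp
    rw [Complex.real_smul, ← e4, ← e3]
    simp only [map_mul, map_inv₀, map_sub, conj_ofReal, map_neg, Complex.conj_I, Complex.conj_conj,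
      map_ofNat]
    rw [show (2 * (Real.pi:ℂ) * -I) = -(2 * Real.pi * I) by ring, inv_neg]
    ring
  · exact (int_mul (int_diff (by simp) hz.ne') hc hb).const_mul _
  · refine Integrable.const_mul ?_ _
    have := int_mul (int_diff (c := -I) (w := z) (by simp) hz.ne') hcc hcb
    exact (Complex.conjCLE.toContinuousLinearMap.integrable_comp this)

lemma part2 {h : ℝ → ℂ} (hc : Continuous h) (hb : Bdd h) :
    IsHarmonicOn (poissonExt h) {z : ℂ | 0 < z.im} := by
  intro z hz
  have hcb : Bdd (fun t => starRingEnd ℂ (h t)) := by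
    obtain ⟨C, hC⟩ := hb
    exact ⟨C, fun x => by simpa using hC x⟩
  have hcc : Continuous (fun t => starRingEnd ℂ (h t)) := Complex.continuous_conj.comp hc
  have hopen : IsOpen {z : ℂ | 0 < z.im} := isOpen_lt continuous_const Complex.continuous_im
  obtain ⟨ε, hε, hsub⟩ := Metric.isOpen_iff.1 hopen z hz
  refine ⟨ε, hε, fun w => (2 * Real.pi * I)⁻¹ * Phi h I w,
    fun w => (2 * Real.pi * I)⁻¹ * Phi (fun t => starRingEnd ℂ (h t)) (-I) w, ?_, ?_, ?_⟩
  · intro w hw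
    exact ((phi_deriv hc hb (by simp) (hsub hw)).const_mul _).differentiableAt.differentiableWithinAt
  · intro w hw
    exact ((phi_deriv hcc hcb (by simp) (hsub hw)).const_mul _).differentiableAt.differentiableWithinAt
  · intro w hw
    exact poisson_decomp hc hb (hsub hw)

lemma conj_diff_iff {g : ℂ → ℂ} {a z : ℂ} (hg : HasDerivAt g a z) :
    DifferentiableAt ℂ (fun w => starRingEnd ℂ (g w)) z ↔ a = 0 := by
  have h1 : HasFDerivAt (𝕜 := ℝ) (fun w => starRingEnd ℂ (g w)) _ z :=
    (Complex.conjCLE.toContinuousLinearMap.hasFDerivAt).comp z (hg.hasFDerivAt.restrictScalars ℝ)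
  constructor
  · intro hd
    have h2 := hd.hasDerivAt.hasFDerivAt.restrictScalars ℝ
    have h3 := h1.unique h2
    have e1 := congrArg (fun L => L 1) h3
    have e2 := congrArg (fun L => L I) h3
    simp at e1 e2
    rw [← e1] at e2
    have : I * starRingEnd ℂ a = 0 := by linear_combination (-1/2) * e2
    simpa using this
  · rintro rfl
    have : HasFDerivAt (𝕜 := ℂ) (fun w => starRingEnd ℂ (g w)) 0 z := by
      refine hasFDerivAt_of_restrictScalars ℝ h1 ?_
      ext; simp
    exact this.differentiableAt

/-- conjugate derivative kernel -/
noncomputable def D (f : ℝ → ℂ) (z : ℂ) : ℂ := ∫ t : ℝ, (((t : ℂ) - starRingEnd ℂ z)⁻¹) ^ 2 * f t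

lemma holo_iff {h : ℝ → ℂ} (hc : Continuous h) (hb : Bdd h) {z : ℂ} (hz : 0 < z.im) :
    DifferentiableAt ℂ (poissonExt h) z ↔ D h z = 0 := by
  have hcb : Bdd (fun t => starRingEnd ℂ (h t)) := by
    obtain ⟨C, hC⟩ := hb
    exact ⟨C, fun x => by simpa using hC x⟩
  have hcc : Continuous (fun t => starRingEnd ℂ (h t)) := Complex.continuous_conj.comp hc
  have hopen : IsOpen {z : ℂ | 0 < z.im} := isOpen_lt continuous_const Complex.continuous_im
  have hF := (phi_deriv hc hb (c := I) (by simp) hz).const_mul (2 * Real.pi * I)⁻¹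
  have hG := (phi_deriv hcc hcb (c := -I) (by simp) hz).const_mul (2 * Real.pi * I)⁻¹
  have hpc : (2 * Real.pi * I : ℂ)⁻¹ ≠ 0 := by simp [Real.pi_pos.ne']
  have hD : D h z = starRingEnd ℂ (∫ t : ℝ, (((t : ℂ) - z)⁻¹) ^ 2 * starRingEnd ℂ (h t)) := by
    rw [D, ← integral_conj]
    congr 1; ext t; simp
  have heq : poissonExt h =ᶠ[nhds z] fun w => (2 * Real.pi * I)⁻¹ * Phi h I w
      + starRingEnd ℂ ((2 * Real.pi * I)⁻¹ * Phi (fun t => starRingEnd ℂ (h t)) (-I) w) := by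
    filter_upwards [hopen.mem_nhds hz] with w hw using poisson_decomp hc hb hw
  have : D h z = 0 ↔ (2 * Real.pi * I : ℂ)⁻¹ * (∫ t : ℝ, (((t : ℂ) - z)⁻¹) ^ 2 * starRingEnd ℂ (h t)) = 0 := by
    rw [hD, map_eq_zero, mul_eq_zero, or_iff_right hpc]
  rw [this, ← conj_diff_iff hG, heq.differentiableAt_iff]
  constructor
  · intro hd
    have := hd.sub hF.differentiableAt
    refine this.congr_of_eventuallyEq (Filter.Eventually.of_forall fun w => ?_)
    simp
  · intro hd
    exact hF.differentiableAt.add hd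

/-- kernel norm -/
noncomputable def N (y : ℝ) : ℝ := ∫ t : ℝ, ‖((t : ℂ) - (-(y * I)))⁻¹‖ ^ 2

lemma D_shift (f : ℝ → ℂ) (x y : ℝ) :
    D f (x + y * I) = ∫ t : ℝ, (((t : ℂ) - (-(y * I)))⁻¹) ^ 2 * f (t + x) := by
  rw [D, ← integral_add_right_eq_self _ x]
  congr 1; ext t
  congr 3
  simp
  ring

lemma im_ne {y : ℝ} (hy : 0 < y) : (-((y:ℂ) * I)).im ≠ 0 := by simpa using hy.ne'

lemma D_le {f : ℝ → ℂ} {C : ℝ} (hC : ∀ x, ‖f x‖ ≤ C) {y : ℝ} (hy : 0 < y) (x : ℝ) :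
    ‖D f (x + y * I)‖ ≤ C * N y := by
  rw [D_shift, N, mul_comm C, ← integral_mul_const]
  refine norm_integral_le_of_norm_le ((integrable_nsq (im_ne hy)).mul_const C)
    (Filter.Eventually.of_forall fun t => ?_)
  rw [norm_mul, norm_pow]
  gcongr
  exact hC _

lemma D_sub {f g : ℝ → ℂ} (hf : Continuous f) (fb : Bdd f) (hg : Continuous g) (gb : Bdd g)
    {z : ℂ} (hz : 0 < z.im) : D (fun x => f x - g x) z = D f z - D g z := by
  have hz' : (starRingEnd ℂ z).im ≠ 0 := by simpa using hz.ne'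
  rw [D, D, D, ← integral_sub (int_mul (int_sq hz') hf fb) (int_mul (int_sq hz') hg gb)]
  simp_rw [mul_sub]

/-- multiplier -/
noncomputable def K (ω y : ℝ) : ℂ := D (fun t => Complex.exp (I * ω * t)) (y * I)

lemma e_trig (ω : ℝ) : IsTrigPoly (fun t => Complex.exp (I * ω * t)) :=
  ⟨{ω}, fun _ => 1, fun x => by simp⟩

lemma D_e (ω x y : ℝ) : D (fun t => Complex.exp (I * ω * t)) (x + y * I) = K ω y * Complex.exp (I * ω * x) := by
  have h0 := D_shift (fun t => Complex.exp (I * ω * t)) 0 y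
  simp only [ofReal_zero, zero_add, add_zero] at h0
  rw [K, h0, D_shift, ← integral_mul_const]
  congr 1; ext t
  push_cast
  rw [mul_add, Complex.exp_add]
  ring

lemma D_trig {p : ℝ → ℂ} {s : Finset ℝ} {c : ℝ → ℂ}
    (hp : ∀ x : ℝ, p x = ∑ ω ∈ s, c ω * Complex.exp (Complex.I * ω * x)) {y : ℝ} (hy : 0 < y) (x : ℝ) :
    D p (x + y * I) = ∑ ω ∈ s, (c ω * K ω y) * Complex.exp (I * ω * x) := by
  have hz' : (starRingEnd ℂ (x + y * I)).im ≠ 0 := by simpa using hy.ne'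
  have : ∀ ω ∈ s, (c ω * K ω y) * Complex.exp (I * ω * x) =
      ∫ t : ℝ, c ω * ((((t : ℂ) - starRingEnd ℂ (x + y * I))⁻¹) ^ 2 * Complex.exp (I * ω * t)) := by
    intro ω _
    rw [integral_const_mul, mul_assoc, ← D_e]
    rfl
  rw [Finset.sum_congr rfl this, ← integral_finsetSum]
  · rw [D]
    congr 1; ext t
    rw [hp, Finset.mul_sum]
    refine Finset.sum_congr rfl fun ω _ => ?_
    ring
  · intro ω _
    exact (int_mul (int_sq hz') (trig_cont (e_trig ω)) (trig_bdd (e_trig ω))).const_mul _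

lemma K_iff (ω : ℝ) {y : ℝ} (hy : 0 < y) : K ω y = 0 ↔ 0 ≤ ω := by
  have hz : 0 < ((y:ℂ) * I).im := by simpa using hy
  have hopen : IsOpen {z : ℂ | 0 < z.im} := isOpen_lt continuous_const Complex.continuous_im
  have hP : poissonExt (fun t => Complex.exp (I * ω * t)) =ᶠ[nhds (y * I)]
      fun z => Complex.exp (I * ω * z.re - |ω| * z.im) := by
    filter_upwards [hopen.mem_nhds hz] with z hz
    rw [poisson_trig (s := {ω}) (c := fun _ => 1) (fun x => by simp) (le_of_lt hz)]
    simp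
  rw [K, ← holo_iff (trig_cont (e_trig ω)) (trig_bdd (e_trig ω)) hz, hP.differentiableAt_iff]
  constructor
  · intro hd
    by_contra! hlt
    have e : (fun z : ℂ => Complex.exp (I * ω * z.re - |ω| * z.im)) =
        fun z => starRingEnd ℂ (Complex.exp (-(I * ω) * z)) := by
      ext z
      rw [← Complex.exp_conj, abs_of_neg hlt]
      congr 1
      apply Complex.ext <;> simp
    rw [e] at hd
    have hg : HasDerivAt (fun z : ℂ => Complex.exp (-(I * ω) * z))
        (Complex.exp (-(I * ω) * (y * I)) * (-(I * ω) * 1)) (y * I) :=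
      ((hasDerivAt_id _).const_mul (-(I * (ω:ℂ)))).cexp
    have := (conj_diff_iff hg).1 hd
    simp [hlt.ne] at this
  · intro h0
    have e : (fun z : ℂ => Complex.exp (I * ω * z.re - |ω| * z.im)) =
        fun z => Complex.exp (I * ω * z) := by
      ext z
      rw [abs_of_nonneg h0]
      congr 1
      apply Complex.ext <;> simp
    rw [e]
    fun_prop

lemma uap_of_approx {f : ℝ → ℂ}
    (hf : ∀ ε : ℝ, 0 < ε → ∃ p : ℝ → ℂ, IsTrigPoly p ∧ ∀ x : ℝ, ‖f x - p x‖ < ε) : IsUAP f := by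
  refine ⟨?_, hf⟩
  refine continuous_of_uniform_approx_of_continuous fun u hu => ?_
  obtain ⟨ε, hε, hsub⟩ := Metric.mem_uniformity_dist.1 hu
  obtain ⟨p, hp, hlt⟩ := hf ε hε
  exact ⟨p, trig_cont hp, fun x => hsub (by rw [dist_eq_norm]; exact hlt x)⟩

lemma N_nonneg (y : ℝ) : 0 ≤ N y := integral_nonneg fun t => by positivity

lemma D_close {h p : ℝ → ℂ} (hc : Continuous h) (hb : Bdd h) (pc : Continuous p) (pb : Bdd p)
    {ε : ℝ} (hlt : ∀ x, ‖h x - p x‖ < ε) {y : ℝ} (hy : 0 < y) (x : ℝ) :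
    ‖D h (x + y * I) - D p (x + y * I)‖ ≤ ε * N y := by
  rw [← D_sub hc hb pc pb (by simpa using hy)]
  exact D_le (fun x => (hlt x).le) hy x

lemma D_uap {h : ℝ → ℂ} (hh : IsUAP h) {y : ℝ} (hy : 0 < y) : IsUAP (fun x => D h (x + y * I)) := by
  refine uap_of_approx fun ε hε => ?_
  have hN := N_nonneg y
  obtain ⟨p, hp, hlt⟩ := hh.2 (ε / (N y + 1)) (by positivity)
  have h1 := D_close hh.1 (uap_bdd hh) (trig_cont hp) (trig_bdd hp) hlt hy
  obtain ⟨s, c, hs⟩ := hp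
  refine ⟨fun x => D p (x + y * I), ⟨s, fun ω => c ω * K ω y, fun x => D_trig hs hy x⟩, fun x => ?_⟩
  refine (h1 x).trans_lt ?_
  rw [div_mul_eq_mul_div, div_lt_iff₀ (by positivity)]
  nlinarith

lemma coeff_D {h : ℝ → ℂ} (hh : IsUAP h) {y : ℝ} (hy : 0 < y) (ω : ℝ) :
    Tendsto (fun L => M (fun x => D h (x + y * I) * Complex.exp (-(I * ω * x))) L
      - K ω y * M (fun x => h x * Complex.exp (-(I * ω * x))) L) atTop (nhds 0) := by
  rw [Metric.tendsto_nhds]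
  intro ε hε
  have hN := N_nonneg y
  set B := N y + ‖K ω y‖ + 1 with hB
  have hB0 : 0 < B := by positivity
  obtain ⟨p, hp, hlt⟩ := hh.2 (ε / (2 * B)) (by positivity)
  have pc := trig_cont hp
  have h1 := D_close hh.1 (uap_bdd hh) pc (trig_bdd hp) hlt hy
  obtain ⟨s, c, hs⟩ := hp
  have ne : ∀ x : ℝ, ‖Complex.exp (-(I * ω * x))‖ = 1 := fun x => by
    rw [← norm_e (-ω) x]; congr 2; push_cast; ring
  have hQ : Tendsto (fun L => M (fun x => D p (x + y * I) * Complex.exp (-(I * ω * x))) L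
      - K ω y * M (fun x => p x * Complex.exp (-(I * ω * x))) L) atTop (nhds 0) := by
    have e : ∀ L, M (fun x => D p (x + y * I) * Complex.exp (-(I * ω * x))) L
      - K ω y * M (fun x => p x * Complex.exp (-(I * ω * x))) L =
        ∑ l ∈ s, (c l * (K l y - K ω y)) * M (fun x => Complex.exp (I * ((l - ω : ℝ) : ℂ) * x)) L := by
      intro L
      rw [← M_const_mul]
      rw [← M_sub]
      · simp_rw [← M_const_mul]
        rw [← M_sum (f := fun (l : ℝ) (x : ℝ) => c l * (K l y - K ω y) * Complex.exp (I * ((l - ω : ℝ) : ℂ) * x)) (by fun_prop)]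
        congr 1; ext x
        rw [D_trig hs hy, hs, Finset.sum_mul, Finset.sum_mul, Finset.mul_sum, ← Finset.sum_sub_distrib]
        refine Finset.sum_congr rfl fun l _ => ?_
        rw [show I * ((l - ω : ℝ) : ℂ) * x = I * l * x + -(I * ω * x) by push_cast; ring, Complex.exp_add]
        ring
      · simp_rw [D_trig hs hy]; fun_prop
      · fun_prop
    simp_rw [e]
    rw [show (0:ℂ) = ∑ l ∈ s, 0 by simp]
    refine tendsto_finsetSum _ fun l _ => ?_
    by_cases hl : l = ω
    · simp [hl]
    · simpa using (M_e_ne (sub_ne_zero.2 hl)).const_mul (c l * (K l y - K ω y))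
  have hDc := (D_uap hh hy).1
  have hDpc : Continuous (fun x : ℝ => D p (x + y * I)) := by
    simp_rw [D_trig hs hy]; fun_prop
  have hc := hh.1
  filter_upwards [(Metric.tendsto_nhds.1 hQ) (ε / 2) (half_pos hε), eventually_gt_atTop 0] with L hL hL0
  rw [dist_zero_right] at hL ⊢
  have a1 : ‖M (fun x => D h (x + y * I) * Complex.exp (-(I * ω * x))) L
      - M (fun x => D p (x + y * I) * Complex.exp (-(I * ω * x))) L‖ ≤ ε / (2 * B) * N y := by
    rw [← M_sub (by fun_prop) (by fun_prop)]
    refine M_norm_le (fun x => ?_) hL0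
    rw [← sub_mul, norm_mul, ne, mul_one]
    exact h1 x
  have a2 : ‖M (fun x => h x * Complex.exp (-(I * ω * x))) L
      - M (fun x => p x * Complex.exp (-(I * ω * x))) L‖ ≤ ε / (2 * B) := by
    rw [← M_sub (by fun_prop) (by fun_prop)]
    refine M_norm_le (fun x => ?_) hL0
    rw [← sub_mul, norm_mul, ne, mul_one]
    exact (hlt x).le
  generalize M (fun x => D h (x + y * I) * Complex.exp (-(I * ω * x))) L = A1 at *
  generalize M (fun x => D p (x + y * I) * Complex.exp (-(I * ω * x))) L = A2 at *
  generalize M (fun x => h x * Complex.exp (-(I * ω * x))) L = A3 at *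
  generalize M (fun x => p x * Complex.exp (-(I * ω * x))) L = A4 at *
  have a3 : ‖K ω y * (A3 - A4)‖ ≤ ‖K ω y‖ * (ε / (2 * B)) := by rw [norm_mul]; gcongr
  calc ‖A1 - K ω y * A3‖ = ‖(A1 - A2) - K ω y * (A3 - A4) + (A2 - K ω y * A4)‖ := by congr 1; ring
    _ ≤ ‖A1 - A2‖ + ‖K ω y * (A3 - A4)‖ + ‖A2 - K ω y * A4‖ :=
      (norm_add_le _ _).trans (add_le_add_left (norm_sub_le _ _) _)
    _ < ε / (2 * B) * B + ε / 2 := by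
      have : ε / (2 * B) * B = ε / (2 * B) * N y + ‖K ω y‖ * (ε / (2 * B)) + ε / (2 * B) := by
        rw [hB]; ring
      have : 0 < ε / (2 * B) := by positivity
      linarith
    _ = ε := by field_simp; ring

lemma trig_shifts {p : ℝ → ℂ} (hp : IsTrigPoly p) {d : ℝ} (hd : 0 < d) :
    ∃ T : Finset ℝ, ∀ t, ∃ τ ∈ T, ∀ x, ‖p (x + t) - p (x + τ)‖ < d := by
  obtain ⟨s, c, hs⟩ := hp
  let v : ℝ → (s → ℂ) := fun t ω => Complex.exp (I * (ω:ℝ) * t)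
  have hsub : Set.range v ⊆ closedBall 0 1 := by
    rintro _ ⟨t, rfl⟩
    rw [mem_closedBall, dist_zero_right, pi_norm_le_iff_of_nonneg zero_le_one]
    intro ω
    exact (norm_e _ _).le
  have htb : TotallyBounded (Set.range v) := (isCompact_closedBall _ _).totallyBounded.subset hsub
  set S := ∑ ω ∈ s, ‖c ω‖ with hS
  have hS0 : 0 ≤ S := Finset.sum_nonneg fun _ _ => norm_nonneg _
  obtain ⟨U, hU, hUf, hcov⟩ := finite_approx_of_totallyBounded htb (d / (S + 1)) (by positivity)
  obtain ⟨T, hTf, rfl⟩ : ∃ T : Set ℝ, T.Finite ∧ v '' T = U := by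
    refine ⟨Function.invFun v '' U, hUf.image _, ?_⟩
    rw [Set.image_image]
    conv_rhs => rw [← Set.image_id U]
    exact Set.image_congr fun u hu => Function.invFun_eq (hU hu)
  refine ⟨hTf.toFinset, fun t => ?_⟩
  have := hcov ⟨t, rfl⟩
  simp only [Set.mem_iUnion, Set.mem_image, exists_prop] at this
  obtain ⟨_, ⟨τ, hτ, rfl⟩, hb⟩ := this
  refine ⟨τ, by simpa using hτ, fun x => ?_⟩
  rw [mem_ball] at hb
  have hco : ∀ ω ∈ s, ‖Complex.exp (I * ω * t) - Complex.exp (I * ω * τ)‖ ≤ d / (S + 1) := by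
    intro ω hω
    have := (dist_le_pi_dist (v t) (v τ) ⟨ω, hω⟩).trans hb.le
    rwa [dist_eq_norm] at this
  rw [hs, hs, ← Finset.sum_sub_distrib]
  calc _ ≤ ∑ ω ∈ s, ‖c ω‖ * (d / (S + 1)) := by
        refine (norm_sum_le _ _).trans (Finset.sum_le_sum fun ω hω => ?_)
        have : c ω * Complex.exp (I * ω * ((x + t : ℝ) : ℂ)) - c ω * Complex.exp (I * ω * ((x + τ : ℝ) : ℂ))
            = c ω * (Complex.exp (I * ω * x) * (Complex.exp (I * ω * t) - Complex.exp (I * ω * τ))) := by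
          push_cast
          rw [mul_add, mul_add, Complex.exp_add, Complex.exp_add]; ring
        rw [this, norm_mul, norm_mul, norm_e, one_mul]
        gcongr
        exact hco ω hω
    _ = S * (d / (S + 1)) := by rw [← Finset.sum_mul]
    _ < d := by
      rw [← mul_div_assoc, div_lt_iff₀ (by positivity)]
      nlinarith

lemma mean_sq_zero {f : ℝ → ℂ} (hf : IsUAP f) (h0 : ∀ ω, BohrCoeffZero f ω) :
    Tendsto (M (fun x => f x * starRingEnd ℂ (f x))) atTop (nhds 0) := by
  rw [Metric.tendsto_nhds]
  intro ε hε
  obtain ⟨C, hC⟩ := uap_bdd hf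
  have hC0 : 0 ≤ C := (norm_nonneg _).trans (hC 0)
  obtain ⟨p, hp, hlt⟩ := hf.2 (ε / (2 * (C + 1))) (by positivity)
  have pc := trig_cont hp
  have fc := hf.1
  obtain ⟨s, c, hs⟩ := hp
  have hQ : Tendsto (M (fun x => f x * starRingEnd ℂ (p x))) atTop (nhds 0) := by
    have e : M (fun x => f x * starRingEnd ℂ (p x)) =
        fun L => ∑ l ∈ s, starRingEnd ℂ (c l) * M (fun x => f x * Complex.exp (-(I * l * x))) L := by
      ext L
      simp_rw [← M_const_mul]
      rw [← M_sum (f := fun (l : ℝ) (x : ℝ) => starRingEnd ℂ (c l) * (f x * Complex.exp (-(I * l * x)))) (by fun_prop)]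
      congr 1; ext x
      rw [hs, map_sum, Finset.mul_sum]
      refine Finset.sum_congr rfl fun l _ => ?_
      rw [map_mul, ← Complex.exp_conj]
      simp only [map_mul, conj_I, conj_ofReal, neg_mul]
      ring
    rw [e, show (0:ℂ) = ∑ l ∈ s, 0 by simp]
    refine tendsto_finsetSum _ fun l _ => ?_
    have := Tendsto.const_mul (starRingEnd ℂ (c l)) (h0 l)
    rw [mul_zero] at this
    exact this
  have cc : Continuous (starRingEnd ℂ) := Complex.continuous_conj
  filter_upwards [(Metric.tendsto_nhds.1 hQ) (ε / 2) (half_pos hε), eventually_gt_atTop 0] with L hL hL0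
  rw [dist_zero_right] at hL ⊢
  have a1 : ‖M (fun x => f x * starRingEnd ℂ (f x)) L - M (fun x => f x * starRingEnd ℂ (p x)) L‖
      ≤ C * (ε / (2 * (C + 1))) := by
    rw [← M_sub (by fun_prop) (by fun_prop)]
    refine M_norm_le (fun x => ?_) hL0
    rw [← mul_sub, ← map_sub, norm_mul, RCLike.norm_conj]
    gcongr
    · exact hC x
    · exact (hlt x).le
  have a2 : C * (ε / (2 * (C + 1))) ≤ ε / 2 := by
    rw [← mul_div_assoc, div_le_iff₀ (by positivity)]
    nlinarith
  calc _ = ‖(M (fun x => f x * starRingEnd ℂ (f x)) L - M (fun x => f x * starRingEnd ℂ (p x)) L)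
        + M (fun x => f x * starRingEnd ℂ (p x)) L‖ := by congr 1; ring
    _ < ε := (norm_add_le _ _).trans_lt (by linarith)

lemma uniqueness {f : ℝ → ℂ} (hf : IsUAP f) (h0 : ∀ ω, BohrCoeffZero f ω) (x₀ : ℝ) : f x₀ = 0 := by
  by_contra hne
  have hpos : 0 < ‖f x₀‖ := norm_pos_iff.2 hne
  set d := ‖f x₀‖ / 4 with hd
  have hd0 : 0 < d := by positivity
  have fc := hf.1
  obtain ⟨p, hp, hlt⟩ := hf.2 d hd0
  obtain ⟨T, hT⟩ := trig_shifts hp hd0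
  have hlow : ∀ t : ℝ, d ^ 2 ≤ ∑ τ ∈ T, ‖f (t + (x₀ - τ))‖ ^ 2 := by
    intro t
    obtain ⟨τ, hτ, hx⟩ := hT t
    have h1 := hx (x₀ - τ)
    rw [sub_add_cancel, add_comm _ t] at h1
    have h2 : d ≤ ‖f (t + (x₀ - τ))‖ := by
      have e' : f x₀ = ((f x₀ - p x₀) - (p (t + (x₀ - τ)) - p x₀))
          - (f (t + (x₀ - τ)) - p (t + (x₀ - τ))) + f (t + (x₀ - τ)) := by ring
      have n1 := norm_add_le (((f x₀ - p x₀) - (p (t + (x₀ - τ)) - p x₀))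
          - (f (t + (x₀ - τ)) - p (t + (x₀ - τ)))) (f (t + (x₀ - τ)))
      have n2 := norm_sub_le ((f x₀ - p x₀) - (p (t + (x₀ - τ)) - p x₀)) (f (t + (x₀ - τ)) - p (t + (x₀ - τ)))
      have n3 := norm_sub_le (f x₀ - p x₀) (p (t + (x₀ - τ)) - p x₀)
      rw [← e'] at n1
      have := hlt x₀
      have := hlt (t + (x₀ - τ))
      linarith
    calc d ^ 2 ≤ ‖f (t + (x₀ - τ))‖ ^ 2 := by gcongr
      _ ≤ _ := Finset.single_le_sum (f := fun τ => ‖f (t + (x₀ - τ))‖ ^ 2) (fun _ _ => by positivity) hτ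
  set A := ∑ τ ∈ T, |x₀ - τ| with hA
  have hAle : ∀ τ ∈ T, |x₀ - τ| ≤ A := fun τ hτ =>
    Finset.single_le_sum (f := fun τ => |x₀ - τ|) (fun _ _ => abs_nonneg _) hτ
  have hM := mean_sq_zero hf h0
  have hMn : ∀ L : ℝ, 0 < L → ‖M (fun x => f x * starRingEnd ℂ (f x)) L‖ = (2 * L)⁻¹ * ∫ t in (-L)..L, ‖f t‖ ^ 2 := by
    intro L hL
    unfold M
    have : ∀ x, f x * starRingEnd ℂ (f x) = ((‖f x‖ ^ 2 : ℝ) : ℂ) := fun x => by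
      rw [Complex.mul_conj, Complex.normSq_eq_norm_sq]
    simp_rw [this]
    rw [intervalIntegral.integral_ofReal, norm_smul, Complex.norm_real, Real.norm_of_nonneg (by positivity),
      Real.norm_of_nonneg]
    exact intervalIntegral.integral_nonneg (by linarith) fun _ _ => by positivity
  have hbound : ∀ᶠ L : ℝ in atTop, d ^ 2 ≤ 2 * T.card * ‖M (fun x => f x * starRingEnd ℂ (f x)) L‖ := by
    filter_upwards [eventually_gt_atTop 0, eventually_ge_atTop (2 * A)] with L hL hLA
    rw [hMn L hL]
    have i1 : (∫ t in (-(L/2))..(L/2), d ^ 2) ≤ ∫ t in (-(L/2))..(L/2), ∑ τ ∈ T, ‖f (t + (x₀ - τ))‖ ^ 2 := by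
      refine intervalIntegral.integral_mono_on (by linarith) (by simp) ?_ fun t _ => hlow t
      exact Continuous.intervalIntegrable (by fun_prop) _ _
    rw [intervalIntegral.integral_const, intervalIntegral.integral_finsetSum
      (fun τ _ => Continuous.intervalIntegrable (by fun_prop) _ _)] at i1
    have i2 : ∀ τ ∈ T, (∫ t in (-(L/2))..(L/2), ‖f (t + (x₀ - τ))‖ ^ 2) ≤ ∫ t in (-L)..L, ‖f t‖ ^ 2 := by
      intro τ hτ
      rw [intervalIntegral.integral_comp_add_right (fun t => ‖f t‖ ^ 2)]
      have := abs_le.1 (hAle τ hτ)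
      refine intervalIntegral.integral_mono_interval (by linarith) (by linarith) (by linarith)
        (Filter.Eventually.of_forall fun t => by positivity)
        (Continuous.intervalIntegrable (by fun_prop) _ _)
    have i3 := i1.trans (Finset.sum_le_sum i2)
    rw [Finset.sum_const, nsmul_eq_mul, smul_eq_mul] at i3
    have : 2 * (T.card:ℝ) * ((2 * L)⁻¹ * ∫ t in (-L)..L, ‖f t‖ ^ 2) = (T.card * ∫ t in (-L)..L, ‖f t‖ ^ 2) / L := by
      field_simp
    rw [this, le_div_iff₀ hL]
    linarith
  have hlim : Tendsto (fun L => 2 * (T.card:ℝ) * ‖M (fun x => f x * starRingEnd ℂ (f x)) L‖) atTop (nhds 0) := by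
    simpa using hM.norm.const_mul (2 * (T.card:ℝ))
  have := ge_of_tendsto hlim hbound
  have : 0 < d ^ 2 := by positivity
  linarith

lemma part4 {h : ℝ → ℂ} (hh : IsUAP h) :
    DifferentiableOn ℂ (poissonExt h) {z : ℂ | 0 < z.im} ↔ ∀ ω : ℝ, ω < 0 → BohrCoeffZero h ω := by
  have hopen : IsOpen {z : ℂ | 0 < z.im} := isOpen_lt continuous_const Complex.continuous_im
  constructor
  · intro hd ω hω
    have hD : ∀ x : ℝ, D h (x + (1:ℝ) * I) = 0 := by
      intro x
      have hz : 0 < ((x:ℂ) + (1:ℝ) * I).im := by simp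
      exact (holo_iff hh.1 (uap_bdd hh) hz).1 (hd.differentiableAt (hopen.mem_nhds hz))
    have hK : K ω 1 ≠ 0 := fun h => absurd ((K_iff ω one_pos).1 h) (not_le.2 hω)
    have hc := coeff_D hh one_pos ω
    simp only [hD, zero_mul] at hc
    have hM0 : ∀ L, M (fun _ => (0:ℂ)) L = 0 := fun L => by simp [M]
    simp only [hM0, zero_sub] at hc
    have := hc.const_mul (-(K ω 1)⁻¹)
    rw [mul_zero] at this
    refine this.congr fun L => ?_
    rw [M]
    field_simp
  · intro h0 z hz
    refine DifferentiableAt.differentiableWithinAt ((holo_iff hh.1 (uap_bdd hh) hz).2 ?_)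
    have hy : 0 < z.im := hz
    have := uniqueness (D_uap hh hy) (fun ω => ?_) z.re
    · simpa using this
    · have hc := coeff_D hh hy ω
      by_cases hω : ω < 0
      · have h1 := Tendsto.const_mul (K ω z.im) (h0 ω hω)
        have h2 := hc.add h1
        rw [mul_zero, add_zero] at h2
        refine h2.congr fun L => ?_
        rw [M, M]
        ring
      · have hK := (K_iff ω hy).2 (not_lt.1 hω)
        simp only [hK, zero_mul, sub_zero] at hc
        exact hc

end UAPP

/-- The Poisson integral `H` of a uniformly almost periodic `h` is continuous on the closed
upper half-plane, harmonic on the open upper half-plane, converges uniformly to the mean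
`m(h)` as `y → ∞`, and is holomorphic on the open upper half-plane iff `Ω(h) ⊆ [0,∞)`. -/
theorem poisson_integral_of_uap (h : ℝ → ℂ) (hh : IsUAP h) :
    ContinuousOn (poissonExt h) {z : ℂ | 0 ≤ z.im} ∧
    IsHarmonicOn (poissonExt h) {z : ℂ | 0 < z.im} ∧
    (∀ m₀ : ℂ, Tendsto (fun L : ℝ => (2 * L)⁻¹ • ∫ t in (-L)..L, h t) atTop (nhds m₀) →
      Tendsto (fun y : ℝ => ⨆ x : ℝ, ‖poissonExt h (x + y * Complex.I) - m₀‖)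
        atTop (nhds 0)) ∧
    (DifferentiableOn ℂ (poissonExt h) {z : ℂ | 0 < z.im} ↔
      ∀ ω : ℝ, ω < 0 → BohrCoeffZero h ω) := by
  exact ⟨UAPP.part1 hh, UAPP.part2 hh.1 (UAPP.uap_bdd hh), fun m₀ hm => UAPP.part3 hh m₀ hm, UAPP.part4 hh⟩
end

section
/- Suppose E is continuous on the closed upper half-plane \mathbb{U} and holomorphic on its interior, \Re E is bounded above on \mathbb{U}, and \Re E = 0 on the real axis. Then E(z) = i\alpha + i\beta z for some \alpha \in \mathbb{R} and \beta \geq 0. -/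
open Complex

open Metric in
lemma disc_aux (G : ℂ → ℂ) (hc : ContinuousOn G (closedBall 0 1 \ {1}))
    (hd : DifferentiableOn ℂ G (ball 0 1)) (hpos : ∀ w ∈ ball (0 : ℂ) 1, 0 ≤ (G w).re)
    (hz : ∀ w : ℂ, ‖w‖ = 1 → w ≠ 1 → (G w).re = 0) (w : ℂ) (hw : w ∈ ball (0 : ℂ) 1) :
    (G w).re = poissonKernel 0 w 1 * (G 0).re := by
  set p := poissonKernel 0 w 1 with hp
  have hw1 : ‖w‖ < 1 := by simpa using hw
  have hPc : ∀ ζ : ℂ, ζ ≠ w → ContinuousAt (poissonKernel 0 w) ζ := by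
    intro ζ hζ
    have h0 : ‖ζ - 0 - (w - 0)‖ ^ 2 ≠ 0 := by simp [sub_eq_zero, hζ]
    have : poissonKernel 0 w =
      fun z : ℂ => (‖z - 0‖ ^ 2 - ‖w - 0‖ ^ 2) / ‖(z - 0) - (w - 0)‖ ^ 2 := rfl
    rw [this]
    exact ContinuousAt.div (by fun_prop) (by fun_prop) h0
  set s := (1 + ‖w‖) / 2 with hs
  -- uniform estimate
  have key : ∀ ε > 0, ∃ r, s ≤ r ∧ r < 1 ∧ ∀ ζ : ℂ, ‖ζ‖ = r →
      |(poissonKernel 0 w ζ - p) * (G ζ).re| ≤ ε * (G ζ).re + ε := by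
    intro ε hε
    have h1w : (1 : ℂ) ≠ w := by rintro rfl; simp at hw1
    obtain ⟨δ, hδ, hδ'⟩ := Metric.continuousAt_iff.1 (hPc 1 h1w) ε hε
    let K : Set ℂ := closedBall 0 1 ∩ ((ball 1 δ)ᶜ ∩ (ball 0 s)ᶜ)
    have hK : IsCompact K := (isCompact_closedBall 0 1).inter_right
      (isOpen_ball.isClosed_compl.inter isOpen_ball.isClosed_compl)
    let h : ℂ → ℝ := fun ζ => |(poissonKernel 0 w ζ - p) * (G ζ).re|
    have hh : ContinuousOn h K := by
      have e1 : ContinuousOn (poissonKernel 0 w) K := by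
        intro ζ hζ
        refine (hPc ζ ?_).continuousWithinAt
        rintro rfl
        have := hζ.2.2
        simp [hs] at this
        linarith
      have e2 : ContinuousOn G K := hc.mono (by
        rintro ζ ⟨h1, h2, h3⟩
        refine ⟨h1, ?_⟩
        rintro rfl
        exact h2 (mem_ball_self hδ))
      exact ((e1.sub continuousOn_const).mul (continuous_re.comp_continuousOn e2)).abs
    have hK2 : IsCompact (K ∩ h ⁻¹' Set.Ici ε) :=
      hK.of_isClosed_subset (hh.preimage_isClosed_of_isClosed hK.isClosed isClosed_Ici)
        Set.inter_subset_left
    obtain ⟨ρ, hρ1, hρ⟩ : ∃ ρ < 1, ∀ ζ ∈ K ∩ h ⁻¹' Set.Ici ε, ‖ζ‖ ≤ ρ := by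
      rcases (K ∩ h ⁻¹' Set.Ici ε).eq_empty_or_nonempty with he | hne
      · exact ⟨0, by norm_num, by simp [he]⟩
      · obtain ⟨x, hx, hmax⟩ := hK2.exists_isMaxOn hne continuous_norm.continuousOn
        refine ⟨‖x‖, ?_, fun ζ hζ => hmax hζ⟩
        have hx1 : ‖x‖ ≤ 1 := by simpa using hx.1.1
        refine lt_of_le_of_ne hx1 fun hx2 => ?_
        have h3 : x ≠ 1 := by
          rintro rfl
          exact hx.1.2.1 (mem_ball_self hδ)
        have h4 : ε ≤ |(poissonKernel 0 w x - p) * (G x).re| := hx.2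
        rw [hz x hx2 h3] at h4
        simp at h4
        linarith
    refine ⟨max s ((1 + ρ) / 2), le_max_left _ _, max_lt (by linarith) (by linarith), ?_⟩
    intro ζ hζ
    have hζ1 : ‖ζ‖ < 1 := by rw [hζ]; exact max_lt (by linarith) (by linarith)
    have hG := hpos ζ (by simpa using hζ1)
    by_cases hd1 : ζ ∈ ball (1 : ℂ) δ
    · have := hδ' hd1
      rw [Real.dist_eq] at this
      rw [abs_mul, abs_of_nonneg hG]
      nlinarith
    · by_contra hcon
      push Not at hcon
      have : ‖ζ‖ ≤ ρ := hρ ζ ⟨⟨by simpa using hζ1.le, hd1, by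
        simp [hζ]⟩, by
          change ε ≤ |(poissonKernel 0 w ζ - p) * (G ζ).re|
          nlinarith⟩
      have := le_max_right s ((1 + ρ) / 2)
      linarith
  have main : ∀ ε > 0, |(G w).re - p * (G 0).re| ≤ ε * (G 0).re + ε := by
    intro ε hε
    obtain ⟨r, hsr, hr1, hr⟩ := key ε hε
    have hwr : ‖w‖ < r := by linarith
    have hr0 : 0 < r := lt_of_le_of_lt (norm_nonneg _) hwr
    have hDC : DiffContOnCl ℂ G (ball 0 r) := by
      apply DifferentiableOn.diffContOnCl
      rw [closure_ball _ hr0.ne']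
      exact hd.mono (closedBall_subset_ball hr1)
    have hDC' : DiffContOnCl ℂ G (ball 0 |r|) := by rwa [abs_of_pos hr0]
    have hGc : ContinuousOn G (sphere 0 r) :=
      hd.continuousOn.mono (sphere_subset_closedBall.trans (closedBall_subset_ball hr1))
    have hPc' : ContinuousOn (poissonKernel 0 w) (sphere 0 r) := by
      intro ζ hζ
      refine (hPc ζ ?_).continuousWithinAt
      rintro rfl
      simp at hζ
      linarith
    have i1 : CircleIntegrable G 0 r := hGc.circleIntegrable hr0.le
    have i2 : CircleIntegrable (poissonKernel 0 w • G) 0 r :=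
      (hPc'.smul hGc).circleIntegrable hr0.le
    have hRe : ContinuousOn (fun ζ => (G ζ).re) (sphere 0 r) :=
      continuous_re.comp_continuousOn hGc
    have a1 : Real.circleAverage (fun ζ => poissonKernel 0 w ζ * (G ζ).re) 0 r = (G w).re := by
      have := hDC.circleAverage_poissonKernel_smul (w := w) (by simpa using hwr)
      rw [← this]
      have h2 := Complex.reCLM.circleAverage_comp_comm i2
      simp only [Complex.reCLM_apply] at h2
      rw [← h2]
      congr 1
      ext ζ
      simp
    have a2 : Real.circleAverage (fun ζ => (G ζ).re) 0 r = (G 0).re := by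
      have := hDC'.circleAverage
      rw [← this]
      have h2 := Complex.reCLM.circleAverage_comp_comm i1
      simp only [Complex.reCLM_apply] at h2
      rw [← h2]
      congr 1
    have a3 : Real.circleAverage (fun ζ => (poissonKernel 0 w ζ - p) * (G ζ).re) 0 r
        = (G w).re - p * (G 0).re := by
      rw [← a1, ← a2, ← smul_eq_mul p, ← Real.circleAverage_fun_smul,
        ← Real.circleAverage_fun_sub]
      · congr 1
        ext ζ
        simp [sub_mul]
      · exact (hPc'.mul hRe).circleIntegrable hr0.le
      · exact (hRe.const_smul p).circleIntegrable hr0.le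
    have a4 : Real.circleAverage (fun ζ => ε * (G ζ).re + ε) 0 r = ε * (G 0).re + ε := by
      rw [← a2, ← smul_eq_mul ε, ← Real.circleAverage_fun_smul, Real.circleAverage_fun_add,
        Real.circleAverage_const]
      · simp
      · exact (continuousOn_const.mul hRe).circleIntegrable hr0.le
      · exact continuousOn_const.circleIntegrable hr0.le
    rw [← a3, ← a4]
    refine Real.abs_circleAverage_le_circleAverage_abs.trans ?_
    apply Real.circleAverage_mono
    · exact (((hPc'.sub continuousOn_const).mul hRe).abs).circleIntegrable hr0.le
    · exact ((continuousOn_const.mul hRe).add continuousOn_const).circleIntegrable hr0.le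
    · intro ζ hζ
      exact hr ζ (by simpa [abs_of_pos hr0] using hζ)
  have hG0 := hpos 0 (by simp)
  have : |(G w).re - p * (G 0).re| ≤ 0 := by
    apply le_of_forall_pos_le_add
    intro e he
    have := main (e / ((G 0).re + 1)) (by positivity)
    calc _ ≤ _ := this
      _ = 0 + e := by field_simp; ring
  linarith [abs_nonpos_iff.1 this]

lemma re_nonpos_aux (E : ℂ → ℂ)
    (hcont : ContinuousOn E {z : ℂ | 0 ≤ z.im})
    (hhol : DifferentiableOn ℂ E {z : ℂ | 0 < z.im})
    (hbd : ∃ C : ℝ, ∀ z : ℂ, 0 ≤ z.im → (E z).re ≤ C)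
    (hre : ∀ x : ℝ, (E x).re = 0) (z : ℂ) (hz : 0 ≤ z.im) : (E z).re ≤ 0 := by
  obtain ⟨C, hC⟩ := hbd
  let f : ℂ → ℂ := fun w => exp (E (I * w))
  have hn : ∀ w : ℂ, ‖f w‖ = Real.exp (E (I * w)).re := fun w => norm_exp _
  have hb : ∀ w : ℂ, 0 ≤ w.re → ‖f w‖ ≤ Real.exp C := by
    intro w hw
    rw [hn]
    exact Real.exp_le_exp.2 (hC _ (by simpa using hw))
  have hdc : DiffContOnCl ℂ f {w | 0 < w.re} := by
    refine ⟨?_, ?_⟩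
    · exact (hhol.comp (by fun_prop) (fun w hw => by simpa using hw)).cexp
    · rw [Complex.closure_setOfPred_lt_re]
      exact (hcont.comp (by fun_prop) (fun w hw => by simpa using hw)).cexp
  have := PhragmenLindelof.right_half_plane_of_bounded_on_real (f := f) (C := 1)
    (z := -I * z) hdc ?_ ?_ ?_ (by simpa using hz)
  · rw [hn] at this
    have h2 : I * (-I * z) = z := by rw [← mul_assoc]; simp
    rw [h2] at this
    simpa using this
  · refine ⟨1, by norm_num, 0, ?_⟩
    refine Asymptotics.IsBigO.of_bound (Real.exp C) ?_
    rw [Filter.eventually_inf_principal]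
    filter_upwards with w hw
    simpa using hb w (le_of_lt hw)
  · refine ⟨Real.exp C, ?_⟩
    rw [Filter.eventually_map]
    filter_upwards [Filter.eventually_ge_atTop (0 : ℝ)] with x hx
    exact hb _ (by simpa using hx)
  · intro x
    rw [hn]
    have : I * ((x : ℂ) * I) = ((-x : ℝ) : ℂ) := by
      push_cast
      linear_combination (x : ℂ) * I_mul_I
    rw [this, hre]
    simp

/-- **A Phragmén–Lindelöf type rigidity statement.**
If `E` is continuous on the closed upper half-plane, holomorphic on its interior, `Re E` is
bounded above there, and `Re E = 0` on the real axis, then `E(z) = iα + iβz` for some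
`α ∈ ℝ` and `β ≥ 0`. -/
theorem re_bounded_above_vanishing_on_real_line (E : ℂ → ℂ)
    (hcont : ContinuousOn E {z : ℂ | 0 ≤ z.im})
    (hhol : DifferentiableOn ℂ E {z : ℂ | 0 < z.im})
    (hbd : ∃ C : ℝ, ∀ z : ℂ, 0 ≤ z.im → (E z).re ≤ C)
    (hre : ∀ x : ℝ, (E x).re = 0) :
    ∃ (α β : ℝ), 0 ≤ β ∧ ∀ z : ℂ, 0 ≤ z.im →
      E z = α * Complex.I + β * Complex.I * z := by
  have hneg := re_nonpos_aux E hcont hhol hbd hre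
  let φ : ℂ → ℂ := fun w => I * ((1 + w) / (1 - w))
  let G : ℂ → ℂ := fun w => -E (φ w)
  have him : ∀ w : ℂ, (φ w).im = (1 - ‖w‖ ^ 2) / ‖1 - w‖ ^ 2 := by
    intro w
    have h1 : poissonKernel 0 w 1 = (herglotzRieszKernel 0 w 1).re :=
      congrFun poissonKernel_eq_re_herglotzRieszKernel 1
    simpa [poissonKernel, herglotzRieszKernel, φ] using h1.symm
  have hφd : ∀ w : ℂ, w ≠ 1 → DifferentiableAt ℂ φ w := by
    intro w hw
    have : 1 - w ≠ 0 := sub_ne_zero.2 (Ne.symm hw)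
    fun_prop (disch := assumption)
  have hball : ∀ w ∈ Metric.ball (0 : ℂ) 1, w ≠ 1 ∧ 0 < (φ w).im := by
    intro w hw
    have hw1 : ‖w‖ < 1 := by simpa using hw
    have hne : w ≠ 1 := by rintro rfl; simp at hw1
    refine ⟨hne, ?_⟩
    rw [him]
    have : 0 < ‖1 - w‖ := norm_pos_iff.2 (sub_ne_zero.2 (Ne.symm hne))
    have : 0 < 1 - ‖w‖ ^ 2 := by nlinarith [norm_nonneg w]
    positivity
  have hGre : ∀ w ∈ Metric.ball (0 : ℂ) 1, (G w).re = poissonKernel 0 w 1 * (G 0).re := by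
    apply disc_aux
    · refine (hcont.comp (fun w hw => (hφd w hw.2).continuousAt.continuousWithinAt) ?_).neg
      rintro w ⟨hw, -⟩
      have hw1 : ‖w‖ ≤ 1 := by simpa using hw
      change 0 ≤ (φ w).im
      rw [him]
      have : 0 ≤ 1 - ‖w‖ ^ 2 := by nlinarith [norm_nonneg w]
      positivity
    · exact (hhol.comp (fun w hw => (hφd w (hball w hw).1).differentiableWithinAt)
        (fun w hw => (hball w hw).2)).neg
    · intro w hw
      have := hneg (φ w) (hball w hw).2.le
      simpa [G] using this
    · intro w hw hw1
      have h0 : (φ w).im = 0 := by rw [him, hw]; simp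
      have : φ w = ((φ w).re : ℂ) := by apply Complex.ext <;> simp [h0]
      simp only [G]
      rw [this, neg_re, hre, neg_zero]
  set β := (G 0).re with hβ
  have hβ0 : 0 ≤ β := by
    have := hneg (φ 0) (hball 0 (by simp)).2.le
    simpa [hβ, G] using this
  have hEre : ∀ z : ℂ, 0 < z.im → (E z).re = -(β * z.im) := by
    intro z hz
    have hzI : z + I ≠ 0 := by
      intro h
      have := congrArg Complex.im h
      simp at this
      linarith
    let w := (z - I) / (z + I)
    have hφw : φ w = z := by
      have h1 : 1 - w = 2 * I / (z + I) := by simp only [w]; field_simp; ring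
      have h2 : 1 + w = 2 * z / (z + I) := by simp only [w]; field_simp; ring
      simp only [φ]
      rw [h1, h2]
      field_simp
    have hw : w ∈ Metric.ball (0 : ℂ) 1 := by
      have : 0 < ‖z + I‖ := norm_pos_iff.2 hzI
      simp only [w, mem_ball_zero_iff, norm_div]
      rw [div_lt_one this]
      apply lt_of_pow_lt_pow_left₀ 2 this.le
      rw [← normSq_eq_norm_sq, ← normSq_eq_norm_sq, normSq_apply, normSq_apply]
      simp
      nlinarith
    have h1 := hGre w hw
    have h2 : poissonKernel 0 w 1 = z.im := by
      rw [← hφw, him]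
      simp [poissonKernel]
    rw [h2] at h1
    simp only [G, hφw, neg_re] at h1
    linarith
  have hopen : IsOpen {z : ℂ | 0 < z.im} := isOpen_lt continuous_const continuous_im
  have hconn : IsConnected {z : ℂ | 0 < z.im} :=
    ⟨⟨I, by simp⟩, (convex_halfSpace_im_gt 0).isPreconnected⟩
  have han : AnalyticOnNhd ℂ (fun z => E z - β * I * z) {z : ℂ | 0 < z.im} :=
    (hhol.sub (by fun_prop)).analyticOnNhd hopen
  obtain ⟨α, hα⟩ := han.eq_re_add_const_mul_I_of_re_eq_const (c₀ := 0)
    (fun z hz => by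
      have := hEre z hz
      simp [this]) hopen hconn
  refine ⟨α, β, hβ0, ?_⟩
  have hcl : closure {z : ℂ | 0 < z.im} = {z : ℂ | 0 ≤ z.im} := Complex.closure_setOfPred_lt_im 0
  have heq : Set.EqOn E (fun z => α * I + β * I * z) {z : ℂ | 0 ≤ z.im} := by
    refine Set.EqOn.of_subset_closure (s := {z : ℂ | 0 < z.im}) ?_ hcont (by fun_prop)
      (fun z hz => (le_of_lt hz.out : (0:ℝ) ≤ z.im)) hcl.ge
    intro z hz
    have := hα z hz
    simp only [ofReal_zero, zero_add] at this
    change E z = _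
    linear_combination this
  exact fun z hz => heq hz
end
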